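/- arXiv:1402.3736 — 2 statements merged into one kernel-verified Lean document; each statement's English description precedes it below -/
import Mathlib

section
/- For every integer d ≥ 3 and every countable partial order (Q, ≤_Q), there exists a family (H_q)_{q ∈ Q} of finite simple graphs, each of maximum vertex degree exactly d, such that for all q, q' ∈ Q one has q ≤_Q q' if and only if there exists a graph homomorphism from the line graph L(H_q) to the line graph L(H_{q'}). In other words, the homomorphism order of line graphs is universal on every interval [K_d, K_{d+1}) for d ≥ 3. -/
open SimpleGraph


namespace LGU

/-! ### Order part -/

inductive D {Q : Type} [PartialOrder Q] (ι : Q → ℕ) (S : Set ℕ) : Q → Prop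
  | a (q : Q) : ι q ∈ S → (∀ r, ι r < ι q → q < r → D ι S r) → D ι S q
  | b (q r : Q) : ι r < ι q → r < q → D ι S r → D ι S q

section order
variable {Q : Type} [PartialOrder Q] {ι : Q → ℕ}

theorem D.mono {S T : Set ℕ} (h : S ⊆ T) {q : Q} (hq : D ι S q) : D ι T q := by
  induction hq with
  | a q h1 _ ih => exact D.a q (h h1) ih
  | b q r h1 h2 _ ih => exact D.b q r h1 h2 ih

theorem D.supp {S : Set ℕ} {q : Q} (hq : D ι S q) : D ι (S ∩ Set.Iic (ι q)) q := by
  induction hq with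
  | a q h1 _ ih =>
    refine D.a q ⟨h1, Set.mem_Iic.2 le_rfl⟩ fun r hr hqr => (ih r hr hqr).mono ?_
    exact Set.inter_subset_inter_right _ (Set.Iic_subset_Iic.2 hr.le)
  | b q r h1 h2 _ ih =>
    refine D.b q r h1 h2 (ih.mono ?_)
    exact Set.inter_subset_inter_right _ (Set.Iic_subset_Iic.2 h1.le)

theorem D.up (hι : Function.Injective ι) {S : Set ℕ} {q : Q} (hq : D ι S q) :
    ∀ q', q ≤ q' → D ι S q' := by
  induction hq with
  | a q h1 h2 ih =>
    intro q' hqq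
    rcases eq_or_lt_of_le hqq with rfl | hlt
    · exact D.a q h1 h2
    · rcases lt_trichotomy (ι q) (ι q') with h | h | h
      · exact D.b q' q h hlt (D.a q h1 h2)
      · exact absurd (hι h) hlt.ne
      · exact h2 q' h hlt
  | b q r h1 h2 h3 ih =>
    intro q' hqq
    exact ih q' (h2.le.trans hqq)

theorem D.of_ge (q0 : Q) : ∀ n, ∀ q, ι q = n → q0 ≤ q → D ι {n | ∃ r, q0 ≤ r ∧ ι r = n} q := by
  intro n
  induction n using Nat.strong_induction_on with
  | _ n ih =>
    rintro q rfl hq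
    exact D.a q ⟨q, hq, rfl⟩ fun r hr hqr => ih _ hr r rfl (hq.trans hqr.le)

theorem D.ge (hι : Function.Injective ι) (q0 : Q) {q : Q}
    (h : D ι {n | ∃ r, q0 ≤ r ∧ ι r = n} q) : q0 ≤ q := by
  induction h with
  | a q h1 _ _ =>
    obtain ⟨r, hr, h⟩ := h1
    exact hι h ▸ hr
  | b q r h1 h2 _ ih => exact ih.trans h2.le

noncomputable def num (S : Finset ℕ) : ℕ := 2 * ∏ i ∈ S, Nat.nth Nat.Prime i

theorem num_dvd {S T : Finset ℕ} : num T ∣ num S ↔ T ⊆ S := by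
  have hp := fun i => Nat.prime_nth_prime i
  unfold num
  rw [Nat.mul_dvd_mul_iff_left (by norm_num)]
  constructor
  · intro h i hi
    have h1 := (Finset.dvd_prod_of_mem (fun i => Nat.nth Nat.Prime i) hi).trans h
    obtain ⟨j, hj, h2⟩ := ((hp i).prime.dvd_finsetProd_iff _).1 h1
    have h3 := (Nat.prime_dvd_prime_iff_eq (hp i) (hp j)).1 h2
    rwa [Nat.nth_injective Nat.infinite_setOfPred_prime h3]
  · intro h
    exact Finset.prod_dvd_prod_of_subset _ _ _ h

theorem num_ge (S : Finset ℕ) : 2 ≤ num S := by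
  have : 0 < ∏ i ∈ S, Nat.nth Nat.Prime i :=
    Finset.prod_pos fun i _ => (Nat.prime_nth_prime i).pos
  unfold num; omega

theorem exists_num (Q : Type) [Countable Q] [PartialOrder Q] :
    ∃ A : Q → Finset ℕ, (∀ q, (A q).Nonempty) ∧ (∀ q, ∀ a ∈ A q, 2 ≤ a) ∧
      ∀ q q', q ≤ q' ↔ ∀ a ∈ A q, ∃ b ∈ A q', b ∣ a := by
  classical
  obtain ⟨ι, hι⟩ := exists_injective_nat Q
  let A : Q → Finset ℕ := fun q =>
    (Finset.filter (fun S : Finset ℕ => D ι (S : Set ℕ) q) (Finset.range (ι q + 1)).powerset).image num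
  have hA : ∀ q a, a ∈ A q ↔ ∃ S : Finset ℕ, S ⊆ Finset.range (ι q + 1) ∧ D ι (S : Set ℕ) q ∧ num S = a := by
    intro q a
    simp only [A, Finset.mem_image, Finset.mem_filter, Finset.mem_powerset, and_assoc]
  have key : ∀ (q : Q) (S : Set ℕ), D ι S q → ∃ T : Finset ℕ, (T : Set ℕ) ⊆ S ∧
      T ⊆ Finset.range (ι q + 1) ∧ D ι (T : Set ℕ) q := by
    intro q S h
    refine ⟨(Finset.range (ι q + 1)).filter (· ∈ S), ?_, Finset.filter_subset _ _, ?_⟩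
    · intro x hx
      simp at hx; exact hx.2
    · refine h.supp.mono ?_
      rintro x ⟨h1, h2⟩
      simp at h2 ⊢
      exact ⟨by omega, h1⟩
  have key2 : ∀ q : Q, ∃ T : Finset ℕ, (T : Set ℕ) ⊆ {n | ∃ r, q ≤ r ∧ ι r = n} ∧
      num T ∈ A q := by
    intro q
    obtain ⟨T, h1, h2, h3⟩ := key q _ (D.of_ge q _ q rfl le_rfl)
    exact ⟨T, h1, (hA _ _).2 ⟨T, h2, h3, rfl⟩⟩
  refine ⟨A, fun q => ?_, ?_, ?_⟩
  · obtain ⟨T, _, h⟩ := key2 q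
    exact ⟨_, h⟩
  · intro q a ha
    obtain ⟨S, _, _, rfl⟩ := (hA _ _).1 ha
    exact num_ge S
  · intro q q'
    constructor
    · intro hq a ha
      obtain ⟨S, h1, h2, rfl⟩ := (hA _ _).1 ha
      obtain ⟨T, h3, h4, h5⟩ := key q' _ (h2.up hι q' hq)
      exact ⟨num T, (hA _ _).2 ⟨T, h4, h5, rfl⟩, num_dvd.2 (by exact_mod_cast h3)⟩
    · intro h
      obtain ⟨S, h1, h2⟩ := key2 q
      obtain ⟨b, hb, hd⟩ := h _ h2
      obtain ⟨T, h3, h4, rfl⟩ := (hA _ _).1 hb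
      have := num_dvd.1 hd
      exact D.ge hι q (h4.mono (Set.Subset.trans (by exact_mod_cast this) h1))

end order

end LGU


namespace LGU
/-! ### Graph construction -/

def inK (k : Fin 8) (b : Bool) : Fin 8 :=
  if b then ![7,0,1,2,6,4,5,7] k else ![7,0,1,2,0,1,3,7] k

structure Core (C : Type) where
  F : C → C
  κ : C → Fin 8
  side : C → Bool
  inj : ∀ a b, F a = F b → side a = side b → a = b
  kin : ∀ a, κ a = inK (κ (F a)) (side a)
  child : ∀ v, κ v ≠ 0 → ∀ b, ∃ a, F a = v ∧ side a = b
  ne7 : ∀ a, κ a ≠ 7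
  no3 : ∀ a, F (F (F a)) ≠ a

abbrev VV (C : Type) (d : ℕ) := C ⊕ (C × Fin d × Bool)

namespace Core
variable {C : Type} (K : Core C) {d : ℕ}

theorem no1 (a : C) : K.F a ≠ a := by
  intro h
  have h1 := K.kin a
  rw [h] at h1
  have h2 := K.ne7 a
  revert h1 h2
  generalize K.κ a = k
  generalize K.side a = b
  revert k b; decide

theorem no2 (a : C) : K.F (K.F a) ≠ a := by
  intro h
  have h1 := K.kin a
  have h3 := K.kin (K.F a)
  rw [h] at h3
  have h2 := K.ne7 a
  revert h1 h2 h3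
  generalize K.κ a = k
  generalize K.κ (K.F a) = k'
  generalize K.side a = b
  generalize K.side (K.F a) = b'
  revert k b k' b'; decide

theorem no4 (a : C) : K.F (K.F (K.F (K.F a))) ≠ a := by
  intro h
  have h1 := K.kin a
  rw [K.kin (K.F a), K.kin (K.F (K.F a)), K.kin (K.F (K.F (K.F a))), h] at h1
  have h2 := K.ne7 a
  revert h1 h2
  generalize K.κ a = k
  generalize K.side a = b
  generalize K.side (K.F a) = b'
  generalize K.side (K.F (K.F a)) = b''
  generalize K.side (K.F (K.F (K.F a))) = b'''
  revert k b b' b'' b'''; decide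

theorem leaf {a v : C} (h : K.F a = v) : K.κ v ≠ 0 := by
  intro h0
  have h1 := K.kin a
  rw [h, h0] at h1
  have h2 := K.ne7 a
  revert h1 h2
  generalize K.κ a = k
  generalize K.side a = b
  revert k b; decide

def adj (d : ℕ) : VV C d → VV C d → Prop
  | .inl a, .inl b => K.F a = b ∨ K.F b = a
  | .inl a, .inr (c, i, _) => K.κ a = 0 ∧ c = a ∧ i.val = 0
  | .inr (c, i, _), .inl a => K.κ a = 0 ∧ c = a ∧ i.val = 0
  | .inr (c, i, b), .inr (c', j, b') =>
      K.κ c = 0 ∧ c' = c ∧ b' = !b ∧ ¬ (i.val = 0 ∧ j.val = 0)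

def G (d : ℕ) : SimpleGraph (VV C d) where
  Adj := K.adj d
  symm := ⟨by
    rintro (a | ⟨c, i, b⟩) (a' | ⟨c', i', b'⟩) h <;> simp only [adj] at h ⊢
    · exact h.symm
    · exact h
    · exact h
    · obtain ⟨h1, rfl, rfl, h4⟩ := h
      refine ⟨h1, rfl, by simp, by tauto⟩⟩
  loopless := ⟨by
    rintro (a | ⟨c, i, b⟩) h <;> simp only [adj] at h
    · exact K.no1 a (by tauto)
    · have := h.2.2.1
      revert this; cases b <;> decide⟩

@[simp] theorem adj_ll {a b : C} : (K.G d).Adj (.inl a) (.inl b) ↔ K.F a = b ∨ K.F b = a := Iff.rfl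
@[simp] theorem adj_lr {a c : C} {i : Fin d} {b : Bool} :
  (K.G d).Adj (.inl a) (.inr (c, i, b)) ↔ K.κ a = 0 ∧ c = a ∧ i.val = 0 := Iff.rfl
@[simp] theorem adj_rl {a c : C} {i : Fin d} {b : Bool} :
  (K.G d).Adj (.inr (c, i, b)) (.inl a) ↔ K.κ a = 0 ∧ c = a ∧ i.val = 0 := Iff.rfl
@[simp] theorem adj_rr {c c' : C} {i j : Fin d} {b b' : Bool} :
  (K.G d).Adj (.inr (c, i, b)) (.inr (c', j, b')) ↔
    K.κ c = 0 ∧ c' = c ∧ b' = !b ∧ ¬ (i.val = 0 ∧ j.val = 0) := Iff.rfl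

theorem triFree {u v w : VV C d} (h1 : (K.G d).Adj u v) (h2 : (K.G d).Adj v w)
    (h3 : (K.G d).Adj u w) : False := by
  have L3 := K.no3
  have L2 := K.no2
  have L1 := K.no1
  rcases u with a | ⟨c, i, b⟩ <;> rcases v with a' | ⟨c', i', b'⟩ <;>
    rcases w with a'' | ⟨c'', i'', b''⟩ <;> simp only [adj_ll, adj_lr, adj_rl, adj_rr] at h1 h2 h3 <;>
    grind

theorem no4c {c : C} {P Q R : VV C d} (h1 : (K.G d).Adj (.inl c) P) (h2 : (K.G d).Adj (.inl c) R)
    (hPR : P ≠ R) (h3 : (K.G d).Adj P Q) (h4 : (K.G d).Adj R Q) (hQ : Q ≠ .inl c) : False := by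
  have L4 := K.no4
  have L2 := K.no2
  have L1 := K.no1
  rcases P with a | ⟨c, i, b⟩ <;> rcases Q with a' | ⟨c', i', b'⟩ <;>
    rcases R with a'' | ⟨c'', i'', b''⟩ <;> simp only [adj_ll, adj_lr, adj_rl, adj_rr] at h1 h2 h3 h4 <;>
    first
    | grind
    | (obtain ⟨_, rfl, h1⟩ := h1
       obtain ⟨_, rfl, h2⟩ := h2
       obtain ⟨_, rfl, rfl, _⟩ := h3
       obtain ⟨_, _, h4, _⟩ := h4
       refine hPR ?_
       have e : i = i'' := Fin.ext (h1.trans h2.symm)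
       have e2 : b = b'' := by revert h4; cases b <;> cases b'' <;> simp
       rw [e, e2])

/-- neighbours of block vertices -/
def nb (c : C) (i : Fin d) (b : Bool) (j : Fin d) : VV C d :=
  if i.val = 0 ∧ j.val = 0 then .inl c else .inr (c, j, !b)

theorem nb_inj (c : C) (i : Fin d) (b : Bool) : Function.Injective (nb c i b) := by
  intro j k h
  unfold nb at h
  split_ifs at h with h1 h2
  · exact Fin.ext (by omega)
  · simpa using h

theorem nb_range {c : C} (hc : K.κ c = 0) (i : Fin d) (b : Bool) :
    (K.G d).neighborSet (.inr (c, i, b)) = Set.range (nb c i b) := by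
  ext v
  simp only [mem_neighborSet, Set.mem_range]
  constructor
  · rcases v with a | ⟨c', j, b'⟩
    · rintro ⟨h1, rfl, h3⟩
      exact ⟨i, by simp [nb, h3]⟩
    · rintro ⟨h1, rfl, rfl, h4⟩
      exact ⟨j, by simp [nb, h4]⟩
  · rintro ⟨j, rfl⟩
    unfold nb
    split_ifs with h
    · simp [hc, h.1]
    · exact ⟨hc, rfl, rfl, h⟩

theorem ncard_blk {c : C} (hc : K.κ c = 0) (i : Fin d) (b : Bool) :
    ((K.G d).neighborSet (.inr (c, i, b))).ncard = d := by
  rw [nb_range K hc, ← Set.image_univ, Set.ncard_image_of_injective _ (nb_inj c i b)]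
  simp

/-- core neighbours -/
theorem nbr_core {v : C} {a₀ a₁ : C} (h0 : K.F a₀ = v) (h1 : K.F a₁ = v)
    (hne : a₀ ≠ a₁) {p : VV C d} (hp : (K.G d).Adj (.inl v) p) :
    p = .inl (K.F v) ∨ p = .inl a₀ ∨ p = .inl a₁ := by
  have hv := K.leaf h0
  have hs : K.side a₀ ≠ K.side a₁ := fun h => hne (K.inj _ _ (h0.trans h1.symm) h)
  rcases p with a | ⟨c, i, b⟩
  · rcases hp with h | h
    · left; rw [h]
    · right
      by_cases h2 : K.side a = K.side a₀
      · left; rw [K.inj _ _ (h.trans h0.symm) h2]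
      · right
        have h3 : K.side a = K.side a₁ := by
          revert h2 hs; cases K.side a <;> cases K.side a₀ <;> cases K.side a₁ <;> simp
        rw [K.inj _ _ (h.trans h1.symm) h3]
  · exact absurd hp.1 hv

theorem nbr_leaf {v : C} (hv : K.κ v = 0) {p : VV C d} (hp : (K.G d).Adj (.inl v) p) :
    p = .inl (K.F v) ∨ ∃ i : Fin d, i.val = 0 ∧ ∃ b, p = .inr (v, i, b) := by
  rcases p with a | ⟨c, i, b⟩
  · rcases hp with h | h
    · left; rw [h]
    · exact absurd hv (K.leaf h)
  · obtain ⟨_, rfl, h⟩ := hp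
    exact Or.inr ⟨i, h, b, rfl⟩

theorem two_children {v : C} (hv : K.κ v ≠ 0) :
    ∃ a₀ a₁, K.F a₀ = v ∧ K.F a₁ = v ∧ a₀ ≠ a₁ ∧ K.side a₀ = false ∧ K.side a₁ = true := by
  obtain ⟨a, h1, h2⟩ := K.child v hv false
  obtain ⟨b, h3, h4⟩ := K.child v hv true
  exact ⟨a, b, h1, h3, by rintro rfl; simp [h2] at h4, h2, h4⟩

theorem ncard_le (hd : 3 ≤ d) (v : VV C d) : ((K.G d).neighborSet v).ncard ≤ d := by
  have h3 : ∀ x y z : VV C d, (K.G d).neighborSet v ⊆ {x, y, z} →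
      ((K.G d).neighborSet v).ncard ≤ d := by
    intro x y z h
    refine le_trans (Set.ncard_le_ncard h (Set.toFinite _)) (le_trans ?_ hd)
    refine (Set.ncard_insert_le _ _).trans ?_
    have := Set.ncard_insert_le y {z}
    rw [Set.ncard_singleton] at this
    omega
  rcases v with v | ⟨c, i, b⟩
  · by_cases hv : K.κ v = 0
    · refine h3 (.inl (K.F v)) (.inr (v, ⟨0, by omega⟩, false)) (.inr (v, ⟨0, by omega⟩, true)) ?_
      intro p hp
      rcases K.nbr_leaf hv hp with h | ⟨i, hi, b, h⟩
      · simp [h]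
      · have : i = ⟨0, by omega⟩ := Fin.ext hi
        rw [h, this]
        cases b <;> simp
    · obtain ⟨a, b, h1, h2, h4, _⟩ := K.two_children hv
      refine h3 (.inl (K.F v)) (.inl a) (.inl b) ?_
      intro p hp
      simpa using K.nbr_core h1 h2 h4 hp
  · by_cases hc : K.κ c = 0
    · exact (K.ncard_blk hc i b).le
    · have : (K.G d).neighborSet (.inr (c, i, b)) = ∅ := by
        ext p
        simp only [mem_neighborSet, Set.mem_empty_iff_false, iff_false]
        rcases p with a | ⟨c', j, b'⟩
        · rintro ⟨h1, rfl, _⟩; exact hc h1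
        · rintro ⟨h1, _⟩; exact hc h1
      simp [this]

/-- `v` has three distinct neighbours -/
def Three {V : Type} (G : SimpleGraph V) (v : V) : Prop :=
  ∃ p q r, p ≠ q ∧ p ≠ r ∧ q ≠ r ∧ G.Adj v p ∧ G.Adj v q ∧ G.Adj v r

theorem three_core (hd : 3 ≤ d) (v : C) : Three (K.G d) (.inl v) := by
  by_cases hv : K.κ v = 0
  · refine ⟨.inl (K.F v), .inr (v, ⟨0, by omega⟩, false), .inr (v, ⟨0, by omega⟩, true), ?_⟩
    simp [hv]
  · obtain ⟨a, b, h1, h2, h4, _⟩ := K.two_children hv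
    refine ⟨.inl (K.F v), .inl a, .inl b, ?_, ?_, ?_, ?_⟩
    · rintro h; simp at h; exact K.no2 a (by rw [h1, h])
    · rintro h; simp at h; exact K.no2 b (by rw [h2, h])
    · simpa using h4
    · simp [h1, h2]

theorem three_blk (hd : 3 ≤ d) {c : C} (hc : K.κ c = 0) (i : Fin d) (b : Bool) :
    Three (K.G d) (.inr (c, i, b)) := by
  have h : ∀ j, (K.G d).Adj (.inr (c, i, b)) (nb c i b j) := by
    intro j
    have : nb c i b j ∈ (K.G d).neighborSet (.inr (c, i, b)) := by
      rw [nb_range K hc]; exact ⟨j, rfl⟩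
    exact this
  refine ⟨nb c i b ⟨0, by omega⟩, nb c i b ⟨1, by omega⟩, nb c i b ⟨2, by omega⟩, ?_, ?_, ?_, h _, h _, h _⟩ <;>
  · rw [(nb_inj c i b).ne_iff]; simp

end Core

end LGU


namespace LGU
open LGU.Core

structure HD {V V' : Type} (G : SimpleGraph V) (H : SimpleGraph V') where
  Φ : V → V → Sym2 V'
  ψ : V → V'
  edge : ∀ {u v}, G.Adj u v → Φ u v ∈ H.edgeSet
  symm : ∀ {u v}, G.Adj u v → Φ u v = Φ v u
  inj : ∀ {v p q}, G.Adj v p → G.Adj v q → p ≠ q → Φ v p ≠ Φ v q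
  mem : ∀ {v p}, Three G v → G.Adj v p → ψ v ∈ Φ v p

theorem common {V : Type} {H : SimpleGraph V}
    (tri : ∀ u v w, H.Adj u v → H.Adj v w → H.Adj u w → False) {e₁ e₂ e₃ : Sym2 V}
    (h1 : e₁ ∈ H.edgeSet) (h2 : e₂ ∈ H.edgeSet) (h3 : e₃ ∈ H.edgeSet)
    (h12 : ∃ x, x ∈ e₁ ∧ x ∈ e₂) (h13 : ∃ x, x ∈ e₁ ∧ x ∈ e₃) (h23 : ∃ x, x ∈ e₂ ∧ x ∈ e₃) :
    ∃ w, w ∈ e₁ ∧ w ∈ e₂ ∧ w ∈ e₃ := by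
  obtain ⟨x, x1, x2⟩ := h12
  obtain ⟨y, y1, y3⟩ := h13
  obtain ⟨z, z2, z3⟩ := h23
  by_cases hxy : x = y
  · subst hxy; exact ⟨x, x1, x2, y3⟩
  by_cases hxz : x = z
  · subst hxz; exact ⟨x, x1, x2, z3⟩
  by_cases hyz : y = z
  · subst hyz; exact ⟨y, y1, z2, y3⟩
  exfalso
  rw [(Sym2.mem_and_mem_iff hxy).1 ⟨x1, y1⟩] at h1
  rw [(Sym2.mem_and_mem_iff hxz).1 ⟨x2, z2⟩] at h2
  rw [(Sym2.mem_and_mem_iff hyz).1 ⟨y3, z3⟩] at h3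
  exact tri x y z h1 h3 h2

theorem fourth {V : Type} {e₁ e₂ e₃ e : Sym2 V} {w : V} (w1 : w ∈ e₁) (w2 : w ∈ e₂) (w3 : w ∈ e₃)
    (h12 : e₁ ≠ e₂) (h13 : e₁ ≠ e₃) (h23 : e₂ ≠ e₃)
    (h1 : ∃ x, x ∈ e ∧ x ∈ e₁) (h2 : ∃ x, x ∈ e ∧ x ∈ e₂) (h3 : ∃ x, x ∈ e ∧ x ∈ e₃) : w ∈ e := by
  by_contra hw
  obtain ⟨x, x0, x1⟩ := h1
  obtain ⟨y, y0, y2⟩ := h2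
  obtain ⟨z, z0, z3⟩ := h3
  have hwx : w ≠ x := by rintro rfl; exact hw x0
  have hwy : w ≠ y := by rintro rfl; exact hw y0
  have hwz : w ≠ z := by rintro rfl; exact hw z0
  have e1 := (Sym2.mem_and_mem_iff hwx).1 ⟨w1, x1⟩
  have e2 := (Sym2.mem_and_mem_iff hwy).1 ⟨w2, y2⟩
  have e3 := (Sym2.mem_and_mem_iff hwz).1 ⟨w3, z3⟩
  have hxy : x ≠ y := by rintro rfl; exact h12 (e1.trans e2.symm)
  have hxz : x ≠ z := by rintro rfl; exact h13 (e1.trans e3.symm)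
  have hyz : y ≠ z := by rintro rfl; exact h23 (e2.trans e3.symm)
  rw [(Sym2.mem_and_mem_iff hxy).1 ⟨x0, y0⟩, Sym2.mem_iff] at z0
  rcases z0 with h | h
  · exact hxz h.symm
  · exact hyz h.symm

theorem exists_HD {V V' : Type} {G : SimpleGraph V} {H : SimpleGraph V'}
    (tri : ∀ u v w, H.Adj u v → H.Adj v w → H.Adj u w → False)
    [Nonempty V'] (φ : G.lineGraph →g H.lineGraph) : Nonempty (HD G H) := by
  classical
  let w0 : V' := Classical.arbitrary V'
  let Φ : V → V → Sym2 V' := fun u v =>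
    if h : G.Adj u v then (φ ⟨s(u, v), h⟩ : Sym2 V') else s(w0, w0)
  have hΦ : ∀ {u v} (h : G.Adj u v), Φ u v = φ ⟨s(u, v), h⟩ := by
    intro u v h; simp only [Φ, dif_pos h]
  have edge : ∀ {u v}, G.Adj u v → Φ u v ∈ H.edgeSet := by
    intro u v h; rw [hΦ h]; exact Subtype.prop _
  have sy : ∀ {u v}, G.Adj u v → Φ u v = Φ v u := by
    intro u v h; rw [hΦ h, hΦ h.symm]
    have : (⟨s(u, v), h⟩ : G.edgeSet) = ⟨s(v, u), h.symm⟩ := Subtype.ext Sym2.eq_swap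
    rw [this]
  have hadj : ∀ {v p q}, G.Adj v p → G.Adj v q → p ≠ q → Φ v p ≠ Φ v q ∧
      ∃ x, x ∈ Φ v p ∧ x ∈ Φ v q := by
    intro v p q hp hq hpq
    have h1 : G.lineGraph.Adj ⟨s(v, p), hp⟩ ⟨s(v, q), hq⟩ := by
      rw [lineGraph_adj_iff_exists]
      refine ⟨?_, v, by simp, by simp⟩
      intro h
      have := congrArg Subtype.val h
      simp only [Sym2.congr_right] at this
      exact hpq this
    have h2 := φ.map_adj h1
    rw [lineGraph_adj_iff_exists] at h2
    rw [hΦ hp, hΦ hq]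
    exact ⟨fun h => h2.1 (Subtype.ext h), h2.2⟩
  have hst : ∀ v, ∃ w, Three G v → ∀ p, G.Adj v p → w ∈ Φ v p := by
    intro v
    by_cases h : Three G v
    · obtain ⟨p, q, r, hpq, hpr, hqr, hp, hq, hr⟩ := h
      obtain ⟨w, w1, w2, w3⟩ := common tri (edge hp) (edge hq) (edge hr)
        (hadj hp hq hpq).2 (hadj hp hr hpr).2 (hadj hq hr hqr).2
      refine ⟨w, fun _ t ht => ?_⟩
      by_cases htp : t = p
      · rwa [htp]
      by_cases htq : t = q
      · rwa [htq]
      by_cases htr : t = r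
      · rwa [htr]
      exact fourth w1 w2 w3 (hadj hp hq hpq).1 (hadj hp hr hpr).1 (hadj hq hr hqr).1
        (hadj ht hp htp).2 (hadj ht hq htq).2 (hadj ht hr htr).2
    · exact ⟨w0, fun h' => absurd h' h⟩
  choose ψ hψ using hst
  exact ⟨⟨Φ, ψ, edge, sy, fun hp hq h => (hadj hp hq h).1, fun h hp => hψ _ h _ hp⟩⟩

namespace HD
section gen
variable {V V' : Type} {G : SimpleGraph V} {H : SimpleGraph V'} (X : HD G H)

theorem out {v p : V} (hv : Three G v) (h : G.Adj v p) :
    ∃ z, X.Φ v p = s(X.ψ v, z) ∧ H.Adj (X.ψ v) z := by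
  obtain ⟨z, hz⟩ := Sym2.mem_iff_exists.1 (X.mem hv h)
  refine ⟨z, hz, ?_⟩
  have := X.edge h
  rwa [hz] at this

theorem dich {u v : V} (hu : Three G u) (hv : Three G v) (h : G.Adj u v) :
    X.ψ u = X.ψ v ∨ (H.Adj (X.ψ u) (X.ψ v) ∧ X.Φ u v = s(X.ψ u, X.ψ v)) := by
  by_cases e : X.ψ u = X.ψ v
  · exact Or.inl e
  · right
    have h1 := X.mem hu h
    have h2 := X.mem hv h.symm
    rw [← X.symm h] at h2
    have h3 := (Sym2.mem_and_mem_iff e).1 ⟨h1, h2⟩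
    have := X.edge h
    rw [h3] at this
    exact ⟨this, h3⟩

theorem loc {v p q : V} (hv : Three G v) (hp : Three G p) (hq : Three G q)
    (h1 : G.Adj v p) (h2 : G.Adj v q) (hpq : p ≠ q) (e : X.ψ p = X.ψ q) : X.ψ v = X.ψ p := by
  rcases X.dich hv hp h1 with h | ⟨_, h3⟩
  · exact h
  rcases X.dich hv hq h2 with h | ⟨_, h4⟩
  · rw [h, e]
  exact absurd (by rw [h3, h4, e]) (X.inj h1 h2 hpq)

end gen

variable {C C' : Type} [Finite C'] {K : Core C} {K' : Core C'} {d : ℕ} (X : HD (K.G d) (K'.G d))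

section blk
variable (hd : 3 ≤ d) {c : C} (hc : K.κ c = 0)
include hd hc

theorem adjp {b : Bool} {i j : Fin d} (h : ¬ (i.val = 0 ∧ j.val = 0)) :
    (K.G d).Adj (.inr (c, i, b)) (.inr (c, j, !b)) := ⟨hc, rfl, rfl, h⟩

theorem const_of_eq {b : Bool} {i j : Fin d} (hij : i ≠ j)
    (e : X.ψ (.inr (c, i, b)) = X.ψ (.inr (c, j, b))) :
    ∃ w, ∀ b i, X.ψ (.inr (c, i, b)) = w := by
  have T := fun (i : Fin d) (b : Bool) => K.three_blk hd hc i b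
  have A1 : ∀ k : Fin d, k.val ≠ 0 → X.ψ (.inr (c, k, !b)) = X.ψ (.inr (c, i, b)) := by
    intro k hk
    refine X.loc (T _ _) (T _ _) (T _ _) (adjp hd hc (b := b) ?_).symm (adjp hd hc (b := b) ?_).symm ?_ e
    · omega
    · omega
    · simpa using hij
  have A2 : ∀ l : Fin d, X.ψ (.inr (c, l, b)) = X.ψ (.inr (c, i, b)) := by
    intro l
    have h1 := A1 ⟨1, by omega⟩ (by simp)
    have h2 := A1 ⟨2, by omega⟩ (by simp)
    rw [← h1]
    refine X.loc (T _ _) (T _ _) (T _ _) (adjp hd hc ?_) (adjp hd hc ?_) ?_ (h1.trans h2.symm) <;> simp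
  have A3 : ∀ k : Fin d, X.ψ (.inr (c, k, !b)) = X.ψ (.inr (c, i, b)) := by
    intro k
    have h1 := A2 ⟨1, by omega⟩
    have h2 := A2 ⟨2, by omega⟩
    rw [← h1]
    refine X.loc (T _ _) (T _ _) (T _ _) (adjp hd hc (b := b) ?_).symm (adjp hd hc (b := b) ?_).symm ?_ (h1.trans h2.symm) <;> simp
  refine ⟨X.ψ (.inr (c, i, b)), fun b' k => ?_⟩
  by_cases hb : b' = b
  · rw [hb]; exact A2 k
  · have : b' = !b := by revert hb; cases b <;> cases b' <;> simp
    rw [this]; exact A3 k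

theorem not_const (w : VV C' d) (h : ∀ b i, X.ψ (.inr (c, i, b)) = w) : False := by
  have T := fun (i : Fin d) (b : Bool) => K.three_blk hd hc i b
  let z : Fin d := ⟨0, by omega⟩
  have hs : ∀ b, (K.G d).Adj (.inr (c, z, b)) (.inl c) := fun b => ⟨hc, rfl, rfl⟩
  obtain ⟨α, hα, hwα⟩ := X.out (T z false) (hs false)
  have nbadj : ∀ (j k : Fin d), (K.G d).Adj (.inr (c, j, true)) (nb c j true k) := by
    intro j k
    have : nb c j true k ∈ (K.G d).neighborSet (.inr (c, j, true)) := by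
      rw [nb_range K hc]; exact ⟨k, rfl⟩
    exact this
  have key : ∀ j : Fin d, ∃ i : Fin d, i ≠ z ∧
      X.Φ (.inr (c, i, false)) (.inr (c, j, true)) = s(w, α) := by
    intro j
    have h1 : ∀ k, ∃ t, X.Φ (.inr (c, j, true)) (nb c j true k) = s(w, t) ∧ (K'.G d).Adj w t := by
      intro k
      have := X.out (T j true) (nbadj j k)
      rwa [h] at this
    choose t ht1 ht2 using h1
    have tinj : Function.Injective t := by
      intro k k' e
      by_contra hk
      exact X.inj (nbadj j k) (nbadj j k') ((nb_inj c j true).ne hk) (by rw [ht1, ht1, e])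
    have hfin : ((K'.G d).neighborSet w).Finite := Set.toFinite _
    have hr : Set.range t = (K'.G d).neighborSet w := by
      refine Set.eq_of_subset_of_ncard_le ?_ ?_ hfin
      · rintro _ ⟨k, rfl⟩; exact ht2 k
      · rw [← Set.image_univ, Set.ncard_image_of_injective _ tinj]
        simpa using K'.ncard_le hd w
    have hα' : α ∈ Set.range t := by
      rw [hr]; rwa [h] at hwα
    obtain ⟨k, hk⟩ := hα'
    have e1 := ht1 k
    rw [hk] at e1
    rw [h] at hα
    by_cases hjk : j.val = 0 ∧ k.val = 0
    · exfalso
      have : nb c j true k = .inl c := by simp [nb, hjk]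
      rw [this] at e1
      have hjz : j = z := Fin.ext hjk.1
      rw [hjz] at e1
      rw [X.symm (hs _)] at e1 hα
      exact X.inj (hs true).symm (hs false).symm (by simp) (e1.trans hα.symm)
    · have e2 : nb c j true k = .inr (c, k, false) := by simp [nb, hjk]
      have e3 := nbadj j k
      rw [e2] at e1 e3
      refine ⟨k, ?_, by rw [← X.symm e3, e1]⟩
      rintro rfl
      rw [X.symm e3] at e1
      exact X.inj e3.symm (hs false) (by simp) (e1.trans hα.symm)
  choose f hf1 hf2 using key
  have finj : Function.Injective f := by
    intro j j' e
    by_contra hj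
    have a1 : (K.G d).Adj (.inr (c, f j, false)) (.inr (c, j, true)) :=
      adjp hd hc (b := false) (fun h => hf1 j (Fin.ext h.1))
    have a2 : (K.G d).Adj (.inr (c, f j, false)) (.inr (c, j', true)) :=
      adjp hd hc (b := false) (fun h => hf1 j (Fin.ext h.1))
    refine X.inj a1 a2 (by simpa using hj) ?_
    rw [hf2 j, e, hf2 j']
  obtain ⟨j, hj⟩ := (Finite.surjective_of_injective finj) z
  exact hf1 j hj

theorem inj_side (b : Bool) : Function.Injective fun i => X.ψ (.inr (c, i, b)) := by
  intro i j h
  by_contra hij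
  obtain ⟨w, hw⟩ := X.const_of_eq hd hc hij h
  exact X.not_const hd hc w hw

theorem ex_two (i : Fin d) : ∃ i1 i2 : Fin d, i1 ≠ i2 ∧ i1 ≠ i ∧ i2 ≠ i := by
  have h0 : 0 < d := by omega
  have h1 : 1 < d := by omega
  have h2 : 2 < d := by omega
  rcases Nat.lt_trichotomy i.val 1 with h | h | h
  · exact ⟨⟨1, h1⟩, ⟨2, h2⟩, by simp, by simp [Fin.ext_iff]; omega, by simp [Fin.ext_iff]; omega⟩
  · exact ⟨⟨0, h0⟩, ⟨2, h2⟩, by simp, by simp [Fin.ext_iff]; omega, by simp [Fin.ext_iff]; omega⟩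
  · exact ⟨⟨0, h0⟩, ⟨1, h1⟩, by simp, by simp [Fin.ext_iff]; omega, by simp [Fin.ext_iff]; omega⟩

theorem cross_aux {b : Bool} {i j : Fin d} (hij : j.val ≠ 0 ∨ i.val = 0)
    (e : X.ψ (.inr (c, i, b)) = X.ψ (.inr (c, j, !b))) : False := by
  have T := fun (i : Fin d) (b : Bool) => K.three_blk hd hc i b
  have h1 : ∃ i1 i2 : Fin d, i1 ≠ i2 ∧ i1 ≠ i ∧ i2 ≠ i := ex_two hd hc i
  obtain ⟨i1, i2, h12, h1i, h2i⟩ := h1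
  have hj : ∃ j' : Fin d, j' ≠ j ∧ j'.val ≠ 0 := by
    by_cases h : j.val = 1
    · exact ⟨⟨2, by omega⟩, by simp [Fin.ext_iff]; omega, by simp⟩
    · exact ⟨⟨1, by omega⟩, by simp [Fin.ext_iff]; omega, by simp⟩
  obtain ⟨j', hj1, hj2⟩ := hj
  have key : ∀ k : Fin d, k ≠ i → X.ψ (.inr (c, k, b)) = X.ψ (.inr (c, j', !b)) := by
    intro k hk
    have hkj : ¬ (k.val = 0 ∧ j.val = 0) := by
      rintro ⟨h3, h4⟩
      rcases hij with h | h
      · exact h h4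
      · exact hk (Fin.ext (h3.trans h.symm))
    have a1 : (K.G d).Adj (.inr (c, k, b)) (.inr (c, j, !b)) := adjp hd hc hkj
    have a2 : (K.G d).Adj (.inr (c, i, b)) (.inr (c, j', !b)) := adjp hd hc (fun h => hj2 h.2)
    have a3 : (K.G d).Adj (.inr (c, k, b)) (.inr (c, j', !b)) := adjp hd hc (fun h => hj2 h.2)
    rcases X.dich (T _ _) (T _ _) a3 with h | ⟨h3, _⟩
    · exact h
    exfalso
    rcases X.dich (T _ _) (T _ _) a1 with h | ⟨h1, _⟩
    · rw [← e] at h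
      exact hk (X.inj_side hd hc b h)
    rcases X.dich (T _ _) (T _ _) a2 with h | ⟨h2, _⟩
    · rw [e] at h
      exact hj1 (X.inj_side hd hc (!b) h.symm)
    rw [← e] at h1
    exact K'.triFree h1 h2 h3
  exact h12 (X.inj_side hd hc b ((key i1 h1i).trans (key i2 h2i).symm))

theorem cross {b : Bool} {i j : Fin d}
    (e : X.ψ (.inr (c, i, b)) = X.ψ (.inr (c, j, !b))) : False := by
  by_cases h : j.val ≠ 0 ∨ i.val = 0
  · exact X.cross_aux hd hc h e
  · refine X.cross_aux hd hc (b := !b) (i := j) (j := i) (Or.inl (by tauto)) ?_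
    rw [Bool.not_not, e]

theorem adj_img {b : Bool} {i j : Fin d} (h : ¬ (i.val = 0 ∧ j.val = 0)) :
    (K'.G d).Adj (X.ψ (.inr (c, i, b))) (X.ψ (.inr (c, j, !b))) ∧
    X.Φ (.inr (c, i, b)) (.inr (c, j, !b)) = s(X.ψ (.inr (c, i, b)), X.ψ (.inr (c, j, !b))) := by
  rcases X.dich (K.three_blk hd hc i b) (K.three_blk hd hc j !b) (adjp hd hc h) with h | h
  · exact (X.cross hd hc h).elim
  · exact h

theorem img_inr (b : Bool) (i : Fin d) : ∃ t, X.ψ (.inr (c, i, b)) = .inr t := by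
  rcases hx : X.ψ (.inr (c, i, b)) with a | t
  · exfalso
    obtain ⟨i', _, _, hi, _⟩ := ex_two hd hc i
    have a1 := (X.adj_img hd hc (b := b) (i := i) (j := ⟨1, by omega⟩) (by simp)).1
    have a2 := (X.adj_img hd hc (b := b) (i := i) (j := ⟨2, by omega⟩) (by simp)).1
    have a3 := (X.adj_img hd hc (b := b) (i := i') (j := ⟨1, by omega⟩) (by simp)).1
    have a4 := (X.adj_img hd hc (b := b) (i := i') (j := ⟨2, by omega⟩) (by simp)).1
    rw [hx] at a1 a2
    refine K'.no4c a1 a2 ?_ a3.symm a4.symm ?_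
    · intro h
      have := X.inj_side hd hc (!b) h
      simp at this
    · rw [← hx]; intro h
      exact hi (X.inj_side hd hc b h)
  · exact ⟨t, rfl⟩

theorem leaf_img : ∃ c', K'.κ c' = 0 ∧ X.Φ (.inl c) (.inl (K.F c)) = s(.inl c', .inl (K'.F c')) := by
  have h0 : 0 < d := by omega
  have h1 : 1 < d := by omega
  have T := fun (i : Fin d) (b : Bool) => K.three_blk hd hc i b
  choose t ht using X.img_inr hd hc
  have A : ∀ b i j, ¬ (i.val = 0 ∧ j.val = 0) → K'.κ (t b i).1 = 0 ∧ (t (!b) j).1 = (t b i).1 ∧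
      (t (!b) j).2.2 = !(t b i).2.2 ∧ ¬ ((t b i).2.1.val = 0 ∧ (t (!b) j).2.1.val = 0) := by
    intro b i j h
    have := (X.adj_img hd hc (b := b) h).1
    rw [ht, ht] at this
    exact this
  let o : Fin d := ⟨1, h1⟩
  let z : Fin d := ⟨0, h0⟩
  let c' := (t true o).1
  let β := (t true o).2.2
  have hc' : K'.κ c' = 0 := (A true o o (by simp [o])).1
  have F1 : ∀ i, (t false i).1 = c' ∧ (t false i).2.2 = !β := by
    intro i
    have := A true o i (by simp [o])
    exact ⟨this.2.1, this.2.2.1⟩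
  have F2 : ∀ i, (t true i).1 = c' ∧ (t true i).2.2 = β := by
    intro i
    have := A false o i (by simp [o])
    simp only [Bool.not_false, F1, Bool.not_not] at this
    exact ⟨this.2.1, this.2.2.1⟩
  have F3 : ∀ b i, (t b i).1 = c' := by
    rintro (_ | _) i
    · exact (F1 i).1
    · exact (F2 i).1
  let γ : Bool → Bool := fun b => if b then β else !β
  have hγ : ∀ b, γ (!b) = !(γ b) := by intro b; cases b <;> simp [γ]
  have F4 : ∀ b i, (t b i).2.2 = γ b := by
    rintro (_ | _) i
    · exact (F1 i).2
    · exact (F2 i).2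
  have ht' : ∀ b i, X.ψ (.inr (c, i, b)) = .inr (c', (t b i).2.1, γ b) := by
    intro b i
    rw [ht, ← F3 b i, ← F4 b i]
  have sinj : ∀ b, Function.Injective fun i => (t b i).2.1 := by
    intro b i j h
    apply X.inj_side hd hc b
    simp only at h ⊢
    rw [ht', ht', h]
  have ssurj : ∀ b, Function.Surjective fun i => (t b i).2.1 := fun b =>
    Finite.surjective_of_injective (sinj b)
  have hz : ∀ b, (t b z).2.1 = z := by
    obtain ⟨i, hi⟩ := ssurj false z
    obtain ⟨j, hj⟩ := ssurj true z
    simp only at hi hj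
    have : i.val = 0 ∧ j.val = 0 := by
      by_contra h
      have := (A false i j h).2.2.2
      simp only [Bool.not_false] at this
      rw [hi, hj] at this
      simp [z] at this
    have e1 : i = z := Fin.ext this.1
    have e2 : j = z := Fin.ext this.2
    rintro (_ | _)
    · rw [← e1, hi, e1]
    · rw [← e2, hj, e2]
  have hs : ∀ b, (K.G d).Adj (.inr (c, z, b)) (.inl c) := fun b => ⟨hc, rfl, rfl⟩
  have P : ∀ b, X.Φ (.inl c) (.inr (c, z, b)) = s(.inl c', .inr (c', z, γ b)) := by
    intro b
    obtain ⟨w, hw, haw⟩ := X.out (T z b) (hs b)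
    rw [← X.symm (hs b), hw]
    rw [ht', hz] at hw haw ⊢
    rcases w with a | ⟨e, k, b'⟩
    · obtain ⟨_, rfl, _⟩ := haw
      exact Sym2.eq_swap
    · exfalso
      obtain ⟨_, rfl, rfl, hk⟩ := haw
      obtain ⟨j, hj⟩ := ssurj (!b) k
      simp only at hj
      have hj0 : j.val ≠ 0 := by
        intro h
        have : j = z := Fin.ext h
        rw [this, hz] at hj
        exact hk ⟨rfl, by rw [← hj]⟩
      have h5 := (X.adj_img hd hc (b := b) (i := z) (j := j) (fun h => hj0 h.2)).2
      rw [ht', ht', hz, hj, hγ] at h5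
      exact X.inj (hs b) (adjp hd hc (fun h => hj0 h.2)) (by simp) (hw.trans h5.symm)
  have hψ : X.ψ (.inl c) = .inl c' := by
    have m1 := X.mem (K.three_core hd c) (hs false).symm
    have m2 := X.mem (K.three_core hd c) (hs true).symm
    rw [P, Sym2.mem_iff] at m1 m2
    rcases m1 with m1 | m1
    · exact m1
    · rcases m2 with m2 | m2
      · exact m2
      · rw [m1] at m2
        have := hγ true
        simp at m2 this
        rw [← m2] at this
        simp at this
  refine ⟨c', hc', ?_⟩
  have hF : (K.G d).Adj (.inl c) (.inl (K.F c)) := Or.inl rfl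
  obtain ⟨w, hw, haw⟩ := X.out (K.three_core hd c) hF
  rw [hψ] at hw haw
  rw [hw]
  rcases K'.nbr_leaf hc' haw with h | ⟨i, hi, b, h⟩
  · rw [h]
  · exfalso
    have hiz : i = z := Fin.ext hi
    have hb : ∃ b', γ b' = b := by
      cases hb : γ true
      · cases b
        · exact ⟨true, hb⟩
        · refine ⟨false, ?_⟩
          have := hγ true; rw [hb] at this; simpa using this
      · cases b
        · refine ⟨false, ?_⟩
          have := hγ true; rw [hb] at this; simpa using this
        · exact ⟨true, hb⟩
    obtain ⟨b', rfl⟩ := hb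
    rw [h, hiz] at hw
    exact X.inj hF (hs b').symm (by simp) (hw.trans (P b').symm)

end blk
end HD
end LGU

namespace LGU
open LGU.Core

namespace HD
variable {C C' : Type} [Finite C'] {K : Core C} {K' : Core C'} {d : ℕ} (X : HD (K.G d) (K'.G d))

/-- the inductive step for marks -/
theorem level_step (hd : 3 ≤ d) (k k1 : Fin 8) (h0 : k1 ≠ 0) (hk : ∀ b, inK k1 b = k)
    (hkk : ∀ b, inK k b ≠ k) (huniq : ∀ l, inK l false = k → inK l true = k → l = k1)
    (ih : ∀ c, K.κ c = k → ∃ c', K'.κ c' = k ∧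
      X.Φ (.inl c) (.inl (K.F c)) = s(.inl c', .inl (K'.F c')))
    (c : C) (hc : K.κ c = k1) :
    ∃ c', K'.κ c' = k1 ∧ X.Φ (.inl c) (.inl (K.F c)) = s(.inl c', .inl (K'.F c')) := by
  obtain ⟨a, b, ha, hb, hab, _, _⟩ := K.two_children (v := c) (by rw [hc]; exact h0)
  have ka : K.κ a = k := by rw [K.kin a, ha, hc, hk]
  have kb : K.κ b = k := by rw [K.kin b, hb, hc, hk]
  obtain ⟨a', ka', ea⟩ := ih a ka
  obtain ⟨b', kb', eb⟩ := ih b kb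
  rw [ha] at ea
  rw [hb] at eb
  have Aa : (K.G d).Adj (.inl c) (.inl a) := Or.inr ha
  have Ab : (K.G d).Adj (.inl c) (.inl b) := Or.inr hb
  have hne := X.inj Aa Ab (by simpa using hab)
  have ma := X.mem (K.three_core hd c) Aa
  have mb := X.mem (K.three_core hd c) Ab
  rw [X.symm Aa, ea] at ma hne
  rw [X.symm Ab, eb] at mb hne
  rw [Sym2.mem_iff] at ma mb
  have hne' : a' ≠ b' := by rintro rfl; exact hne rfl
  have bad : ∀ x y : C', K'.κ x = k → K'.κ y = k → K'.F y ≠ x := by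
    intro x y hx hy h
    have := K'.kin y
    rw [h, hx, hy] at this
    exact hkk _ this.symm
  have main : X.ψ (.inl c) = .inl (K'.F a') ∧ K'.F a' = K'.F b' := by
    rcases ma with ma | ma <;> rcases mb with mb | mb <;> rw [ma] at mb <;> simp at mb
    · exact absurd mb hne'
    · exact absurd mb.symm (bad _ _ ka' kb')
    · exact absurd mb (bad _ _ kb' ka')
    · exact ⟨ma, mb⟩
  obtain ⟨hψ, hF⟩ := main
  refine ⟨K'.F a', ?_, ?_⟩
  · have hs : K'.side a' ≠ K'.side b' := fun h => hne' (K'.inj _ _ hF h)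
    have e1 := K'.kin a'
    have e2 := K'.kin b'
    rw [← hF, kb'] at e2
    rw [ka'] at e1
    apply huniq
    · cases h1 : K'.side a'
      · rw [h1] at e1; exact e1.symm
      · cases h2 : K'.side b'
        · rw [h2] at e2; exact e2.symm
        · exact absurd (h1.trans h2.symm) hs
    · cases h1 : K'.side a'
      · cases h2 : K'.side b'
        · exact absurd (h1.trans h2.symm) hs
        · rw [h2] at e2; exact e2.symm
      · rw [h1] at e1; exact e1.symm
  · have hFc : (K.G d).Adj (.inl c) (.inl (K.F c)) := Or.inl rfl
    obtain ⟨w, hw, haw⟩ := X.out (K.three_core hd c) hFc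
    rw [hψ] at hw haw
    rw [hw]
    rcases K'.nbr_core rfl hF.symm hne' haw with h | h | h
    · rw [h]
    · exfalso
      refine X.inj hFc Aa ?_ ?_
      · intro h; simp at h; exact K.no2 a (by rw [ha, h])
      · rw [hw, X.symm Aa, ea, h]; exact Sym2.eq_swap
    · exfalso
      refine X.inj hFc Ab ?_ ?_
      · intro h; simp at h; exact K.no2 b (by rw [hb, h])
      · rw [hw, X.symm Ab, eb, h, hF]; exact Sym2.eq_swap

theorem lev0 (hd : 3 ≤ d) (c : C) (hc : K.κ c = 0) :
    ∃ c', K'.κ c' = 0 ∧ X.Φ (.inl c) (.inl (K.F c)) = s(.inl c', .inl (K'.F c')) :=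
  X.leaf_img hd hc

theorem lev1 (hd : 3 ≤ d) (c : C) (hc : K.κ c = 1) :
    ∃ c', K'.κ c' = 1 ∧ X.Φ (.inl c) (.inl (K.F c)) = s(.inl c', .inl (K'.F c')) :=
  X.level_step hd 0 1 (by decide) (by decide) (by decide) (by decide) (X.lev0 hd) c hc

theorem lev2 (hd : 3 ≤ d) (c : C) (hc : K.κ c = 2) :
    ∃ c', K'.κ c' = 2 ∧ X.Φ (.inl c) (.inl (K.F c)) = s(.inl c', .inl (K'.F c')) :=
  X.level_step hd 1 2 (by decide) (by decide) (by decide) (by decide) (X.lev1 hd) c hc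

theorem lev3 (hd : 3 ≤ d) (c : C) (hc : K.κ c = 3) :
    ∃ c', K'.κ c' = 3 ∧ X.Φ (.inl c) (.inl (K.F c)) = s(.inl c', .inl (K'.F c')) :=
  X.level_step hd 2 3 (by decide) (by decide) (by decide) (by decide) (X.lev2 hd) c hc

/-- where cycle vertices can go -/
theorem cyc (hd : 3 ≤ d) (k l : Fin 8) (hl0 : l ≠ 0) (hl : inK l false = k)
    (lev : ∀ c, K.κ c = k → ∃ c', K'.κ c' = k ∧
      X.Φ (.inl c) (.inl (K.F c)) = s(.inl c', .inl (K'.F c')))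
    (c : C) (hc : K.κ c = l) :
    ∃ w, X.ψ (.inl c) = .inl w ∧ (K'.κ w = k ∨ ∃ b, inK (K'.κ w) b = k) := by
  obtain ⟨a, ha, hs⟩ := K.child c (by rw [hc]; exact hl0) false
  have ka : K.κ a = k := by rw [K.kin a, ha, hc, hs, hl]
  obtain ⟨a', ka', ea⟩ := lev a ka
  rw [ha] at ea
  have Aa : (K.G d).Adj (.inl c) (.inl a) := Or.inr ha
  have ma := X.mem (K.three_core hd c) Aa
  rw [X.symm Aa, ea, Sym2.mem_iff] at ma
  rcases ma with ma | ma
  · exact ⟨a', ma, Or.inl ka'⟩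
  · exact ⟨_, ma, Or.inr ⟨K'.side a', by rw [← K'.kin, ka']⟩⟩

theorem dichc (hd : 3 ≤ d) {c : C} {w v : C'} (hw : X.ψ (.inl c) = .inl w)
    (hv : X.ψ (.inl (K.F c)) = .inl v) :
    w = v ∨ (K'.F w = v ∧ ∃ b, K'.κ w = inK (K'.κ v) b) ∨
      (K'.F v = w ∧ ∃ b, K'.κ v = inK (K'.κ w) b) := by
  have hFc : (K.G d).Adj (.inl c) (.inl (K.F c)) := Or.inl rfl
  rcases X.dich (K.three_core hd _) (K.three_core hd _) hFc with h | ⟨h, _⟩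
  · left; rw [hw, hv] at h; simpa using h
  · right
    rw [hw, hv] at h
    rcases h with h | h
    · left; exact ⟨h, K'.side w, by rw [← h]; exact K'.kin w⟩
    · right; exact ⟨h, K'.side v, by rw [← h]; exact K'.kin v⟩

theorem fwd (k : Fin 8) (h : k = 4 ∨ k = 5 ∨ k = 6) {l m : Fin 8} (hl : l = 4 ∨ l = 5 ∨ l = 6)
   (b : Bool) (hm : k = inK l b) (hm' : k = inK m true) (hmm : m = 4 ∨ m = 5 ∨ m = 6) : l = m := by
  revert k l m b; decide

/-- kinds of next vertices on the cycle -/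
theorem fin1 : ∀ (v w : Fin 8), (w = 3 ∨ ∃ b, inK w b = 3) → (v = 0 ∨ ∃ b, inK v b = 0) →
    v ≠ 7 → w ≠ 7 →
    (w = v ∨ (∃ b, w = inK v b) ∨ (∃ b, v = inK w b)) → w = 6 ∧ v = 4 := by decide

theorem fin2 : ∀ (v : Fin 8), (v = 1 ∨ ∃ b, inK v b = 1) → v ≠ 7 →
    ((4 : Fin 8) = v ∨ (∃ b, 4 = inK v b) ∨ (∃ b, v = inK 4 b)) → v = 5 := by decide

theorem cyc6 (hd : 3 ≤ d) (c : C) (hc : K.κ c = 6) (hFc : K.κ (K.F c) = 4) :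
    ∃ w, X.ψ (.inl c) = .inl w ∧ X.ψ (.inl (K.F c)) = .inl (K'.F w) ∧ K'.κ w = 6 ∧
      K'.κ (K'.F w) = 4 := by
  obtain ⟨w, hw, kw⟩ := X.cyc hd 3 6 (by decide) (by decide) (X.lev3 hd) c hc
  obtain ⟨v, hv, kv⟩ := X.cyc hd 0 4 (by decide) (by decide) (X.lev0 hd) _ hFc
  have D := X.dichc hd hw hv
  have E : K'.κ w = 6 ∧ K'.κ v = 4 := by
    refine fin1 _ _ kw kv (K'.ne7 _) (K'.ne7 _) ?_
    rcases D with h | h | h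
    · left; rw [h]
    · exact Or.inr (Or.inl h.2)
    · exact Or.inr (Or.inr h.2)
  have : K'.F w = v := by
    rcases D with h | h | ⟨_, b, h⟩
    · rw [h, E.2] at E; exact absurd E.1 (by decide)
    · exact h.1
    · rw [E.1, E.2] at h; exfalso; revert h; revert b; decide
  exact ⟨w, hw, by rw [this]; exact hv, E.1, by rw [this]; exact E.2⟩

theorem cyc4 (hd : 3 ≤ d) (c : C) (hc : K.κ c = 4) (hFc : K.κ (K.F c) = 5) :
    ∃ w, X.ψ (.inl c) = .inl w ∧ X.ψ (.inl (K.F c)) = .inl (K'.F w) ∧ K'.κ w = 4 ∧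
      K'.κ (K'.F w) = 5 := by
  obtain ⟨a, ha, hs⟩ := K.child c (by rw [hc]; decide) true
  have ka : K.κ a = 6 := by rw [K.kin a, ha, hc, hs]; decide
  obtain ⟨w, hw, h1, h2, h3⟩ := X.cyc6 hd a ka (by rw [ha, hc])
  rw [ha] at h1
  obtain ⟨v, hv, kv⟩ := X.cyc hd 1 5 (by decide) (by decide) (X.lev1 hd) _ hFc
  have D := X.dichc hd h1 hv
  rw [h3] at D
  have E : K'.κ v = 5 := by
    refine fin2 _ kv (K'.ne7 _) ?_
    rcases D with h | h | h
    · left; rw [← h, h3]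
    · exact Or.inr (Or.inl h.2)
    · exact Or.inr (Or.inr h.2)
  have : K'.F (K'.F w) = v := by
    rcases D with h | h | ⟨_, b, h⟩
    · rw [h, E] at h3; exact absurd h3 (by decide)
    · exact h.1
    · rw [E] at h; exfalso; revert h; revert b; decide
  exact ⟨_, h1, by rw [this]; exact hv, h3, by rw [this]; exact E⟩

theorem cyc5 (hd : 3 ≤ d) (c : C) (hc : K.κ c = 5) (hFc : K.κ (K.F c) = 6)
    (hFFc : K.κ (K.F (K.F c)) = 4) :
    ∃ w, X.ψ (.inl c) = .inl w ∧ X.ψ (.inl (K.F c)) = .inl (K'.F w) := by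
  obtain ⟨a, ha, hs⟩ := K.child c (by rw [hc]; decide) true
  have ka : K.κ a = 4 := by rw [K.kin a, ha, hc, hs]; decide
  obtain ⟨w, hw, h1, h2, h3⟩ := X.cyc4 hd a ka (by rw [ha, hc])
  rw [ha] at h1
  obtain ⟨v, hv, h4, h5, h6⟩ := X.cyc6 hd _ hFc hFFc
  have D := X.dichc hd h1 hv
  rw [h3, h5] at D
  refine ⟨_, h1, ?_⟩
  rw [hv]
  rcases D with h | h | ⟨_, b, h⟩
  · rw [h, h5] at h3; exact absurd h3 (by decide)
  · rw [h.1]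
  · exfalso; revert h; revert b; decide

theorem step3 (hd : 3 ≤ d) (c : C) (h0 : K.κ c = 4) (h1 : K.κ (K.F c) = 5)
    (h2 : K.κ (K.F (K.F c)) = 6) (h3 : K.κ (K.F (K.F (K.F c))) = 4) :
    ∃ w, K'.κ w = 4 ∧ X.ψ (.inl c) = .inl w ∧
      X.ψ (.inl (K.F (K.F (K.F c)))) = .inl (K'.F (K'.F (K'.F w))) := by
  obtain ⟨w, a1, a2, a3, a4⟩ := X.cyc4 hd c h0 h1
  obtain ⟨w', b1, b2⟩ := X.cyc5 hd _ h1 h2 h3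
  obtain ⟨w'', c1, c2, _, _⟩ := X.cyc6 hd _ h2 h3
  rw [a2] at b1
  have e1 := Sum.inl_injective b1
  subst e1
  rw [b2] at c1
  have e2 := Sum.inl_injective c1
  subst e2
  exact ⟨w, a3, a1, c2⟩

end HD

/-- Maps of cores induce line graph homomorphisms -/
theorem exists_hom {C C' : Type} {K : Core C} {K' : Core C'} (d : ℕ) (g : C → C')
    (gF : ∀ c, g (K.F c) = K'.F (g c)) (gκ : ∀ c, K'.κ (g c) = K.κ c)
    (gs : ∀ c, K'.side (g c) = K.side c) : Nonempty ((K.G d).lineGraph →g (K'.G d).lineGraph) := by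
  let f : VV C d → VV C' d
    | .inl c => .inl (g c)
    | .inr (c, i, b) => .inr (g c, i, b)
  have hf : ∀ u v, (K.G d).Adj u v → (K'.G d).Adj (f u) (f v) := by
    rintro (a | ⟨c, i, b⟩) (a' | ⟨c', i', b'⟩) h
    · rcases h with h | h
      · left; rw [← gF, h]
      · right; rw [← gF, h]
    · obtain ⟨h1, rfl, h3⟩ := h
      exact ⟨by rw [gκ, h1], rfl, h3⟩
    · obtain ⟨h1, rfl, h3⟩ := h
      exact ⟨by rw [gκ, h1], rfl, h3⟩
    · obtain ⟨h1, rfl, h3, h4⟩ := h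
      exact ⟨by rw [gκ, h1], rfl, h3, h4⟩
  have hinj : ∀ v p q, (K.G d).Adj v p → (K.G d).Adj v q → f p = f q → p = q := by
    have L2 := K'.no2
    have Li := K.inj
    rintro (a | ⟨c, i, b⟩) (a' | ⟨c', i', b'⟩) (a'' | ⟨c'', i'', b''⟩) h1 h2 e <;>
      simp only [adj_ll, adj_lr, adj_rl, adj_rr] at h1 h2 <;>
      simp only [f, Sum.inl.injEq, Sum.inr.injEq, Prod.mk.injEq, reduceCtorEq] at e ⊢ <;>
      grind
  refine ⟨⟨fun e => ⟨e.1.map f, ?_⟩, ?_⟩⟩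
  · rcases e with ⟨e, he⟩
    induction e using Sym2.ind with
    | _ u v => exact hf u v he
  · rintro ⟨e, he⟩ ⟨e', he'⟩ h
    rw [lineGraph_adj_iff_exists] at h ⊢
    obtain ⟨hne, v, h1, h2⟩ := h
    obtain ⟨p, rfl⟩ := Sym2.mem_iff_exists.1 h1
    obtain ⟨q, rfl⟩ := Sym2.mem_iff_exists.1 h2
    refine ⟨?_, f v, by simp, by simp⟩
    intro h
    have h3 := congrArg Subtype.val h
    simp only [Sym2.map_mk, Sym2.congr_right] at h3
    exact hne (Subtype.ext (by simp only; rw [hinj v p q he he' h3]))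

/-! ### concrete cores -/

def F0 : Fin 22 → Fin 22 := ![1,2,0,0,1,4,4,2,7,7,8,8,9,9,10,10,11,11,12,12,13,13]
def κ0 : Fin 22 → Fin 8 := ![4,5,6,0,1,0,0,3,2,2,1,1,1,1,0,0,0,0,0,0,0,0]
def side0 : Fin 22 → Bool := ![true,true,true,false,false,false,true,false,false,true,
  false,true,false,true,false,true,false,true,false,true,false,true]
def sh (u : Fin 22) : ℕ := if u = 2 then 1 else 0

theorem t_inj : ∀ a b, F0 a = F0 b → side0 a = side0 b → a = b := by decide
theorem t_kin : ∀ a, κ0 a = inK (κ0 (F0 a)) (side0 a) := by decide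
theorem t_child : ∀ v, κ0 v ≠ 0 → ∀ b, ∃ a, F0 a = v ∧ side0 a = b := by decide
theorem t_ne7 : ∀ a, κ0 a ≠ 7 := by decide
theorem t_no3 : ∀ a, F0 (F0 (F0 a)) = a → sh a + sh (F0 a) + sh (F0 (F0 a)) = 1 := by decide
theorem t_four : ∀ a, κ0 a = 4 → a = 0 := by decide

abbrev CC (A : Finset ℕ) := Σ a : A, ZMod a × Fin 22

def core (A : Finset ℕ) (hA : ∀ a ∈ A, 2 ≤ a) : Core (CC A) where
  F x := ⟨x.1, x.2.1 + sh x.2.2, F0 x.2.2⟩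
  κ x := κ0 x.2.2
  side x := side0 x.2.2
  inj := by
    rintro ⟨a, i, u⟩ ⟨b, j, v⟩ h hs
    simp only [Sigma.mk.injEq] at h
    obtain ⟨rfl, h⟩ := h
    simp only [heq_eq_eq, Prod.mk.injEq] at h
    have := t_inj u v h.2 hs
    subst this
    simpa using h.1
  kin x := t_kin _
  child := by
    rintro ⟨a, i, v⟩ h b
    obtain ⟨u, h1, h2⟩ := t_child v h b
    exact ⟨⟨a, i - sh u, u⟩, by simp [h1], h2⟩
  ne7 x := t_ne7 _
  no3 := by
    rintro ⟨a, i, u⟩ h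
    simp only [Sigma.mk.injEq, heq_eq_eq, Prod.mk.injEq, true_and] at h
    have h1 := t_no3 u h.2
    have h2 : ((sh u + sh (F0 u) + sh (F0 (F0 u)) : ℕ) : ZMod a) = 0 := by
      have := h.1
      push_cast
      rw [add_assoc, add_assoc] at this
      rw [add_assoc]
      simpa using this
    rw [h1, ZMod.natCast_eq_zero_iff] at h2
    have := hA _ a.2
    have := Nat.le_of_dvd one_pos h2
    omega

theorem finite_CC (A : Finset ℕ) (hA : ∀ a ∈ A, 2 ≤ a) : Finite (CC A) := by
  have : ∀ a : A, Finite (ZMod a) := fun a => by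
    have : NeZero (a : ℕ) := ⟨by have := hA _ a.2; omega⟩
    infer_instance
  infer_instance

theorem core_F3 (A : Finset ℕ) (hA : ∀ a ∈ A, 2 ≤ a) (a : A) (i : ZMod a) :
    (core A hA).F ((core A hA).F ((core A hA).F ⟨a, i, 0⟩)) = ⟨a, i + 1, 0⟩ := by
  simp [core, F0, sh]

theorem hom_iff (d : ℕ) (hd : 3 ≤ d) (A B : Finset ℕ) (hA : ∀ a ∈ A, 2 ≤ a) (hB : ∀ a ∈ B, 2 ≤ a)
    (hne : B.Nonempty) :
    (∀ a ∈ A, ∃ b ∈ B, b ∣ a) ↔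
      Nonempty (((core A hA).G d).lineGraph →g ((core B hB).G d).lineGraph) := by
  constructor
  · intro h
    have h' : ∀ a : A, ∃ b : B, (b : ℕ) ∣ a := fun a => by
      obtain ⟨b, hb, hd⟩ := h a.1 a.2
      exact ⟨⟨b, hb⟩, hd⟩
    choose β hβ using h'
    refine exists_hom d (fun x => ⟨β x.1, ZMod.castHom (hβ x.1) (ZMod (β x.1)) x.2.1, x.2.2⟩) ?_ ?_ ?_
    · rintro ⟨a, i, u⟩
      have e := map_add (ZMod.castHom (hβ a) (ZMod (β a))) i (sh u : ZMod a)
      rw [map_natCast] at e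
      exact congrArg (fun z => (⟨β a, z, F0 u⟩ : CC B)) e
    · rintro ⟨a, i, u⟩; rfl
    · rintro ⟨a, i, u⟩; rfl
  · rintro ⟨φ⟩ a ha
    have := finite_CC B hB
    have : Nonempty (VV (CC B) d) := by
      obtain ⟨b, hb⟩ := hne
      exact ⟨.inl ⟨⟨b, hb⟩, 0, 0⟩⟩
    obtain ⟨X⟩ := exists_HD (fun u v w h1 h2 h3 => (core B hB).triFree h1 h2 h3) φ
    have st : ∀ i : ZMod a, ∃ w, (core B hB).κ w = 4 ∧ X.ψ (.inl ⟨⟨a, ha⟩, i, 0⟩) = .inl w ∧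
        X.ψ (.inl ⟨⟨a, ha⟩, i + 1, 0⟩) =
          .inl ((core B hB).F ((core B hB).F ((core B hB).F w))) := by
      intro i
      rw [← core_F3 A hA ⟨a, ha⟩ i]
      exact X.step3 hd _ rfl rfl rfl rfl
    obtain ⟨w, kw, hw, _⟩ := st 0
    obtain ⟨b, j, u⟩ := w
    have hu : u = 0 := t_four u kw
    subst hu
    have it : ∀ n : ℕ, X.ψ (.inl ⟨⟨a, ha⟩, (n : ZMod a), 0⟩) = .inl ⟨b, j + n, 0⟩ := by
      intro n
      induction n with
      | zero => simpa using hw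
      | succ n ih =>
        obtain ⟨w', _, h1, h2⟩ := st n
        rw [ih] at h1
        have := Sum.inl_injective h1
        subst this
        rw [core_F3] at h2
        rw [Nat.cast_succ, Nat.cast_succ, h2, add_assoc]
    have h1 := it a
    rw [ZMod.natCast_self] at h1
    rw [hw] at h1
    simp only [Sum.inl.injEq, Sigma.mk.injEq, heq_eq_eq, Prod.mk.injEq, true_and, and_true] at h1
    have h2 : ((a : ℕ) : ZMod b) = 0 := by simpa using h1.symm
    exact ⟨b, b.2, (ZMod.natCast_eq_zero_iff _ _).1 h2⟩

end LGU

/-- **Universality of intervals of the line graph order.**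
For every `d ≥ 3` and every countable partial order `Q`, there is a family of finite
simple graphs `H q`, each of maximum vertex degree exactly `d`, such that `q ≤ q'`
iff there is a graph homomorphism `L(H q) → L(H q')`. -/
theorem line_graph_interval_universal (d : ℕ) (hd : 3 ≤ d)
    (Q : Type) [Countable Q] [PartialOrder Q] :
    ∃ (V : Q → Type) (_ : ∀ q, Fintype (V q)) (H : ∀ q, SimpleGraph (V q)),
      (∀ q, (∀ v, ((H q).neighborSet v).ncard ≤ d) ∧
        ∃ v, ((H q).neighborSet v).ncard = d) ∧
      (∀ q q' : Q, q ≤ q' ↔ Nonempty ((H q).lineGraph →g (H q').lineGraph)) := by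
  classical
  obtain ⟨A, hne, h2, hle⟩ := LGU.exists_num Q
  refine ⟨fun q => LGU.VV (LGU.CC (A q)) d, fun q => ?_, fun q => (LGU.core (A q) (h2 q)).G d,
    fun q => ⟨?_, ?_⟩, fun q q' => ?_⟩
  · have := LGU.finite_CC (A q) (h2 q)
    haveI : Finite (LGU.VV (LGU.CC (A q)) d) := by
      unfold LGU.VV
      infer_instance
    exact Fintype.ofFinite _
  · exact fun v => LGU.Core.ncard_le _ hd v
  · obtain ⟨a, ha⟩ := hne q
    exact ⟨.inr (⟨⟨a, ha⟩, 0, 3⟩, ⟨0, by omega⟩, false), LGU.Core.ncard_blk _ rfl _ _⟩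
  · rw [hle]
    exact LGU.hom_iff d hd _ _ (h2 q) (h2 q') (hne q')
end

section
/- For every d ≥ 3, n ≥ 3 and n' ≥ 3, there exists a graph homomorphism from L(G_{n,d}) to L(G_{n',d}) if and only if n' divides n. -/
open SimpleGraph

/-- The edge relation of the `d`-dragon on vertex indices `0,…,d+1`:
vertices `0,…,d` are pairwise adjacent except `0` and `d`, and vertex `d+1`
is adjacent exactly to `0` and `d`. -/
def dragonRel (d : ℕ) (u v : ℕ) : Prop :=
  (u < d + 1 ∧ v < d + 1 ∧ ¬(u = 0 ∧ v = d) ∧ ¬(u = d ∧ v = 0)) ∨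
  (u = d + 1 ∧ (v = 0 ∨ v = d))

/-- The `d`-dragon `D_d`: `K_{d+1}` with one edge replaced by a path on 3 vertices. -/
def dragon (d : ℕ) : SimpleGraph (Fin (d + 2)) :=
  SimpleGraph.fromRel (fun u v => dragonRel d u.val v.val)

/-- The `n`-sunlet: a cycle `C_n` (`Sum.inl` vertices) with a pendant vertex
(`Sum.inr`) attached to each cycle vertex. -/
def sunlet (n : ℕ) : SimpleGraph (Fin n ⊕ Fin n) :=
  SimpleGraph.fromRel (fun u v =>
    match u, v with
    | Sum.inl i, Sum.inl j => j.val = (i.val + 1) % n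
    | Sum.inl i, Sum.inr j => i = j
    | _, _ => False)

/-- The internal part of the indicator `I_d(a,b)` on indices `0,…,d+2`:
indices `0,…,d+1` form the dragon `D_d`, and index `d+2` is the middle vertex `c`,
joined to the degree-2 vertex `d+1` of the dragon. -/
def indicatorInternalRel (d k l : ℕ) : Prop :=
  dragonRel d k l ∨ (k = d + 2 ∧ l = d + 1)

/-- The graph `G_{n,d} = S_n * I_d(a,b)`: every edge `{x,y}` of the sunlet `S_n` is
replaced by a fresh copy of the indicator `I_d(a,b)` with `a,b` identified with `x,y`.
Sunlet vertices are `Sum.inl`; the copy of the indicator sitting on the cycle edge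
`{i, i+1}` is indexed by `(i,0)`, the copy on the pendant edge `{i, pendant i}` is
indexed by `(i,1)`; in each copy, index `d+2` is the middle vertex `c`, adjacent to
the two endpoints of the corresponding sunlet edge, and indices `0,…,d+1` form the dragon. -/
def sunletIndicator (n d : ℕ) :
    SimpleGraph ((Fin n ⊕ Fin n) ⊕ ((Fin n × Fin 2) × Fin (d + 3))) :=
  SimpleGraph.fromRel (fun u v =>
    match u, v with
    | Sum.inr (e, k), Sum.inr (e', l) => e = e' ∧ indicatorInternalRel d k.val l.val
    | Sum.inl x, Sum.inr (e, k) =>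
        k.val = d + 2 ∧
        (x = Sum.inl e.1 ∨
         (e.2.val = 0 ∧ ∃ j : Fin n, j.val = (e.1.val + 1) % n ∧ x = Sum.inl j) ∨
         (e.2.val = 1 ∧ x = Sum.inr e.1))
    | _, _ => False)

/-- Disjoint union of an indexed family of simple graphs. -/
def sigmaGraph {ι : Type*} {V : ι → Type*} (G : ∀ i, SimpleGraph (V i)) :
    SimpleGraph (Σ i, V i) :=
  SimpleGraph.fromRel (fun x y =>
    ∃ (i : ι) (u v : V i), (G i).Adj u v ∧ x = ⟨i, u⟩ ∧ y = ⟨i, v⟩)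

namespace SunHom

def IR (d k l : ℕ) : Prop :=
  (k ≠ l ∧ k < d + 1 ∧ l < d + 1 ∧ ¬(k = 0 ∧ l = d) ∧ ¬(k = d ∧ l = 0)) ∨
  (k = d + 1 ∧ (l = 0 ∨ l = d)) ∨ (l = d + 1 ∧ (k = 0 ∨ k = d)) ∨
  (k = d + 2 ∧ l = d + 1) ∨ (l = d + 2 ∧ k = d + 1)

instance (d k l : ℕ) : Decidable (IR d k l) := by unfold IR; infer_instance

def inc {n : ℕ} (x : Fin n ⊕ Fin n) (e : Fin n × Fin 2) : Prop :=
  x = Sum.inl e.1 ∨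
    (e.2.val = 0 ∧ ∃ j : Fin n, j.val = (e.1.val + 1) % n ∧ x = Sum.inl j) ∨
    (e.2.val = 1 ∧ x = Sum.inr e.1)

abbrev VV (n d : ℕ) := (Fin n ⊕ Fin n) ⊕ ((Fin n × Fin 2) × Fin (d + 3))

def D {n d : ℕ} (e : Fin n × Fin 2) (k : ℕ) : VV n d := Sum.inr (e, Fin.ofNat (d + 3) k)

lemma D_inj {n d : ℕ} {e e' : Fin n × Fin 2} {k l : ℕ} (hk : k < d + 3) (hl : l < d + 3) :
    (D e k : VV n d) = D e' l ↔ e = e' ∧ k = l := by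
  unfold D
  simp only [Sum.inr.injEq, Prod.mk.injEq, Fin.ext_iff, Fin.val_ofNat, Nat.mod_eq_of_lt hk,
    Nat.mod_eq_of_lt hl]

lemma D_ne_inl {n d : ℕ} {e : Fin n × Fin 2} {k : ℕ} {x} :
    (D e k : VV n d) ≠ Sum.inl x := by
  simp [D]

lemma inl_ne_D {n d : ℕ} {e : Fin n × Fin 2} {k : ℕ} {x} :
    Sum.inl x ≠ (D e k : VV n d) := by
  simp [D]

lemma V_cases {n d : ℕ} (v : VV n d) : (∃ x, v = Sum.inl x) ∨ ∃ e k, k < d + 3 ∧ v = D e k := by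
  rcases v with x | ⟨e, k⟩
  · exact Or.inl ⟨x, rfl⟩
  · refine Or.inr ⟨e, k.val, k.isLt, ?_⟩
    simp only [D, Sum.inr.injEq, Prod.mk.injEq, Fin.ext_iff, Fin.val_ofNat, Nat.mod_eq_of_lt k.isLt]
    trivial

lemma adj_DD {n d : ℕ} {e e' : Fin n × Fin 2} {k l : ℕ} (hk : k < d + 3) (hl : l < d + 3) :
    (sunletIndicator n d).Adj (D e k) (D e' l) ↔ e = e' ∧ IR d k l := by
  have h1 := D_inj (n := n) (e := e) (e' := e') hk hl
  rw [sunletIndicator, SimpleGraph.fromRel_adj, Ne, h1]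
  unfold D
  simp only [Fin.val_ofNat, Nat.mod_eq_of_lt hk, Nat.mod_eq_of_lt hl]
  unfold indicatorInternalRel dragonRel IR
  by_cases he : e = e'
  · subst he
    simp only [true_and]
    omega
  · have he' : ¬ e' = e := fun h => he h.symm
    simp [he, he']

lemma adj_lD {n d : ℕ} {e : Fin n × Fin 2} {k : ℕ} {x} (hk : k < d + 3) :
    (sunletIndicator n d).Adj (Sum.inl x) (D e k) ↔ k = d + 2 ∧ inc x e := by
  rw [sunletIndicator, SimpleGraph.fromRel_adj]
  unfold D inc
  simp only [Fin.val_ofNat, Nat.mod_eq_of_lt hk]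
  simp

lemma adj_Dl {n d : ℕ} {e : Fin n × Fin 2} {k : ℕ} {x} (hk : k < d + 3) :
    (sunletIndicator n d).Adj (D e k) (Sum.inl x) ↔ k = d + 2 ∧ inc x e := by
  rw [SimpleGraph.adj_comm, adj_lD hk]

lemma adj_ll {n d : ℕ} {x y} :
    ¬ (sunletIndicator n d).Adj (Sum.inl x) (Sum.inl y) := by
  rw [sunletIndicator, SimpleGraph.fromRel_adj]
  simp

structure LH {V V' : Type*} (G : SimpleGraph V) (G' : SimpleGraph V') (F : V → V → Sym2 V') :
    Prop where
  symm : ∀ u v, F u v = F v u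
  mem : ∀ u v, G.Adj u v → F u v ∈ G'.edgeSet
  adj : ∀ u v w, G.Adj u v → G.Adj u w → v ≠ w →
    F u v ≠ F u w ∧ ∃ z, z ∈ F u v ∧ z ∈ F u w

lemma exists_LH {V V' : Type*} [Nonempty V'] (G : SimpleGraph V) (G' : SimpleGraph V')
    (f : G.lineGraph →g G'.lineGraph) : ∃ F, LH G G' F := by
  classical
  let z : V' := Classical.arbitrary V'
  let F0 : Sym2 V → Sym2 V' := fun p => if h : p ∈ G.edgeSet then (f ⟨p, h⟩).1 else s(z, z)
  refine ⟨fun u v => F0 s(u, v), ?_, ?_, ?_⟩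
  · intro u v
    rw [Sym2.eq_swap]
  · intro u v h
    have h' : s(u, v) ∈ G.edgeSet := h
    simp only [F0, h', dif_pos]
    exact (f ⟨s(u, v), h'⟩).2
  · intro u v w hv hw hne
    have hv' : s(u, v) ∈ G.edgeSet := hv
    have hw' : s(u, w) ∈ G.edgeSet := hw
    simp only [F0, hv', hw', dif_pos]
    have : G.lineGraph.Adj ⟨s(u, v), hv'⟩ ⟨s(u, w), hw'⟩ := by
      rw [SimpleGraph.lineGraph_adj_iff_exists]
      refine ⟨?_, u, by simp, by simp⟩
      intro h
      apply hne
      exact Sym2.congr_right.1 (congrArg Subtype.val h)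
    have h2 := f.map_adj this
    rw [SimpleGraph.lineGraph_adj_iff_exists] at h2
    refine ⟨fun h => h2.1 (Subtype.ext h), h2.2⟩

/-- converse direction: a locally injective homomorphism induces a line graph homomorphism -/
lemma lineGraph_hom_of_locInj {V V' : Type*} (G : SimpleGraph V) (G' : SimpleGraph V')
    (p : V → V') (hp : ∀ u v, G.Adj u v → G'.Adj (p u) (p v))
    (hi : ∀ u v w, G.Adj u v → G.Adj u w → p v = p w → v = w) :
    Nonempty (G.lineGraph →g G'.lineGraph) := by
  have hm : ∀ e ∈ G.edgeSet, Sym2.map p e ∈ G'.edgeSet := by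
    intro e
    induction e using Sym2.ind with
    | _ u v => exact hp u v
  refine ⟨⟨fun e => ⟨Sym2.map p e.1, hm e.1 e.2⟩, ?_⟩⟩
  rintro ⟨a, ha⟩ ⟨b, hb⟩ h
  rw [SimpleGraph.lineGraph_adj_iff_exists] at h ⊢
  obtain ⟨hne, u, hua, hub⟩ := h
  simp only at hua hub
  obtain ⟨v, rfl⟩ := hua
  obtain ⟨w, rfl⟩ := hub
  refine ⟨?_, p u, by simp, by simp⟩
  intro h
  apply hne
  have h' := congrArg Subtype.val h
  simp only [Sym2.map_mk, Sym2.congr_right] at h'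
  have := hi u v w ha hb h'
  subst this
  rfl

lemma mod_ne {n' : ℕ} (h : 2 ≤ n') (i : ℕ) : i % n' ≠ (i + 1) % n' := by
  intro h1
  have h2 : i ≡ i + 1 [MOD n'] := h1
  have h3 := (Nat.modEq_iff_dvd' (by omega)).1 h2
  rw [Nat.add_sub_cancel_left] at h3
  have := Nat.le_of_dvd (by omega) h3
  omega

end SunHom
namespace SunHom

lemma mod_succ_mod {n n' : ℕ} (h : n' ∣ n) (i : ℕ) : ((i + 1) % n) % n' = (i % n' + 1) % n' := by
  rw [Nat.mod_mod_of_dvd _ h, Nat.mod_add_mod]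

def fm {n n' : ℕ} (h0 : 0 < n') (i : Fin n) : Fin n' := ⟨i.val % n', Nat.mod_lt _ h0⟩

def sm {n n' : ℕ} (h0 : 0 < n') : Fin n ⊕ Fin n → Fin n' ⊕ Fin n' := Sum.map (fm h0) (fm h0)

def em {n n' : ℕ} (h0 : 0 < n') (e : Fin n × Fin 2) : Fin n' × Fin 2 := (fm h0 e.1, e.2)

def pj {n n' : ℕ} (d : ℕ) (h0 : 0 < n') : VV n d → VV n' d :=
  Sum.map (sm h0) (Prod.map (em h0) id)

lemma pj_D {n n' d : ℕ} (h0 : 0 < n') (e : Fin n × Fin 2) (k : ℕ) :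
    pj d h0 (D e k) = D (em h0 e) k := by
  simp [pj, D]

lemma pj_inl {n n' d : ℕ} (h0 : 0 < n') (x) :
    pj (n := n) d h0 (Sum.inl x) = Sum.inl (sm h0 x) := by
  simp [pj]

lemma inc_sm {n n' : ℕ} (h0 : 0 < n') (h : n' ∣ n) {x} {e : Fin n × Fin 2} (hx : inc x e) :
    inc (sm h0 x) (em h0 e) := by
  rcases hx with rfl | ⟨h1, j, hj, rfl⟩ | ⟨h1, rfl⟩
  · left; rfl
  · right; left
    refine ⟨h1, fm h0 j, ?_, rfl⟩
    simp only [fm, em, hj]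
    exact mod_succ_mod h _
  · right; right
    exact ⟨h1, rfl⟩

lemma inc_inj_x {n n' : ℕ} (h2 : 2 ≤ n') (h0 : 0 < n') (h : n' ∣ n) {x y} {e : Fin n × Fin 2}
    (hx : inc x e) (hy : inc y e) (hs : sm h0 x = sm h0 y) : x = y := by
  have hm := mod_ne h2 e.1.val
  rcases hx with rfl | ⟨h1, j, hj, rfl⟩ | ⟨h1, rfl⟩ <;>
  rcases hy with rfl | ⟨h1', j', hj', rfl⟩ | ⟨h1', rfl⟩ <;>
  simp only [sm, fm, Sum.map_inl, Sum.map_inr, Sum.inl.injEq, Sum.inr.injEq, Fin.mk.injEq,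
    reduceCtorEq, Fin.ext_iff] at hs ⊢
  · rw [hj', Nat.mod_mod_of_dvd _ h] at hs
    exact absurd hs hm
  · rw [hj, Nat.mod_mod_of_dvd _ h] at hs
    exact absurd hs.symm hm
  · omega

lemma inc_inj_e {n n' : ℕ} (h2 : 2 ≤ n') (h0 : 0 < n') (h : n' ∣ n) {x} {e f : Fin n × Fin 2}
    (he : inc x e) (hf : inc x f) (hs : em h0 e = em h0 f) : e = f := by
  obtain ⟨e1, e2⟩ := e
  obtain ⟨f1, f2⟩ := f
  simp only [em, fm, Prod.mk.injEq, Fin.mk.injEq] at hs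
  obtain ⟨hs1, rfl⟩ := hs
  have hme := mod_ne h2 e1.val
  have hmf := mod_ne h2 f1.val
  simp only [Prod.mk.injEq, and_true]
  unfold inc at he hf
  simp only at he hf
  rcases he with rfl | ⟨h1, j, hj, rfl⟩ | ⟨h1, rfl⟩ <;>
  rcases hf with h3 | ⟨h1', j', hj', h3⟩ | ⟨h1', h3⟩ <;>
  simp only [Sum.inl.injEq, Sum.inr.injEq, reduceCtorEq] at h3
  · exact h3
  · subst h3
    rw [hj', Nat.mod_mod_of_dvd _ h] at hs1
    exact absurd hs1.symm hmf
  · subst h3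
    rw [hj, Nat.mod_mod_of_dvd _ h] at hs1
    exact absurd hs1 hme
  · subst h3
    have h4 : e1.val + 1 ≡ f1.val + 1 [MOD n] := hj.symm.trans hj'
    have h5 : e1.val ≡ f1.val [MOD n] := Nat.ModEq.add_right_cancel' 1 h4
    have h6 : e1.val % n = f1.val % n := h5
    rw [Nat.mod_eq_of_lt e1.isLt, Nat.mod_eq_of_lt f1.isLt] at h6
    exact Fin.ext h6
  · exact h3

lemma hom_of_dvd (d n n' : ℕ) (hn' : 3 ≤ n') (h : n' ∣ n) :
    Nonempty ((sunletIndicator n d).lineGraph →g (sunletIndicator n' d).lineGraph) := by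
  have h0 : 0 < n' := by omega
  have h2 : 2 ≤ n' := by omega
  apply lineGraph_hom_of_locInj _ _ (pj d h0)
  · intro u v huv
    rcases V_cases u with ⟨x, rfl⟩ | ⟨e, k, hk, rfl⟩ <;>
    rcases V_cases v with ⟨y, rfl⟩ | ⟨e', l, hl, rfl⟩ <;>
    simp only [pj_D, pj_inl]
    · exact absurd huv adj_ll
    · rw [adj_lD hl] at huv ⊢
      exact ⟨huv.1, inc_sm h0 h huv.2⟩
    · rw [adj_Dl hk] at huv ⊢
      exact ⟨huv.1, inc_sm h0 h huv.2⟩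
    · rw [adj_DD hk hl] at huv ⊢
      exact ⟨by rw [huv.1], huv.2⟩
  · intro u v w huv huw hvw
    rcases V_cases u with ⟨x, rfl⟩ | ⟨e, k, hk, rfl⟩ <;>
    rcases V_cases v with ⟨y, rfl⟩ | ⟨e', l, hl, rfl⟩ <;>
    rcases V_cases w with ⟨z, rfl⟩ | ⟨e'', m, hm, rfl⟩ <;>
    simp only [pj_D, pj_inl] at hvw
    · exact absurd huv adj_ll
    · exact absurd huv adj_ll
    · exact absurd huw adj_ll
    · rw [adj_lD hl] at huv
      rw [adj_lD hm] at huw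
      rw [D_inj hl hm] at hvw ⊢
      exact ⟨inc_inj_e h2 h0 h huv.2 huw.2 hvw.1, hvw.2⟩
    · rw [adj_Dl hk] at huv huw
      rw [inc_inj_x h2 h0 h huv.2 huw.2 (Sum.inl.inj hvw)]
    · exact absurd hvw inl_ne_D
    · exact absurd hvw D_ne_inl
    · rw [adj_DD hk hl] at huv
      rw [adj_DD hk hm] at huw
      rw [D_inj hl hm] at hvw ⊢
      exact ⟨huv.1.symm.trans huw.1, hvw.2⟩

end SunHom
namespace SunHom

lemma IR_d1 {d l : ℕ} (hd : 3 ≤ d) : IR d (d + 1) l ↔ l = 0 ∨ l = d ∨ l = d + 2 := by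
  unfold IR; omega

lemma IR_d2 {d l : ℕ} : IR d (d + 2) l ↔ l = d + 1 := by
  unfold IR; omega

lemma adj_r {n d : ℕ} (hd : 3 ≤ d) {e : Fin n × Fin 2} {y : VV n d} :
    (sunletIndicator n d).Adj (D e (d + 1)) y ↔ y = D e 0 ∨ y = D e d ∨ y = D e (d + 2) := by
  rcases V_cases y with ⟨x, rfl⟩ | ⟨e', k, hk, rfl⟩
  · rw [adj_Dl (by omega)]
    simp only [inl_ne_D, or_self, iff_false]
    omega
  · rw [adj_DD (by omega) hk, D_inj hk (by omega), D_inj hk (by omega), D_inj hk (by omega),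
      IR_d1 hd, ← and_or_left, ← and_or_left, eq_comm]

lemma adj_c {n d : ℕ} {e : Fin n × Fin 2} {y : VV n d} :
    (sunletIndicator n d).Adj (D e (d + 2)) y ↔
      y = D e (d + 1) ∨ ∃ x, inc x e ∧ y = Sum.inl x := by
  rcases V_cases y with ⟨x, rfl⟩ | ⟨e', k, hk, rfl⟩
  · rw [adj_Dl (by omega)]
    simp [inl_ne_D]
  · rw [adj_DD (by omega) hk, D_inj hk (by omega), IR_d2, eq_comm]
    simp [D_ne_inl]

lemma adj_0d {n d : ℕ} (hd : 3 ≤ d) {e : Fin n × Fin 2} :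
    ¬ (sunletIndicator n d).Adj (D e 0) (D e d) := by
  rw [adj_DD (by omega) (by omega)]
  unfold IR; omega

lemma edge_mem {V : Type*} {G : SimpleGraph V} {p : Sym2 V} (h : p ∈ G.edgeSet) {v : V}
    (hv : v ∈ p) : ∃ w, G.Adj v w ∧ p = s(v, w) := by
  obtain ⟨w, rfl⟩ := hv
  exact ⟨w, h, rfl⟩

def T {n d : ℕ} (e : Fin n × Fin 2) (p : Sym2 (VV n d)) : Prop :=
  p = s(D e 0, D e (d + 1)) ∨ p = s(D e d, D e (d + 1))

def U {n d : ℕ} (e : Fin n × Fin 2) (p : Sym2 (VV n d)) : Prop :=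
  ∃ y, inc y e ∧ p = s(Sum.inl y, D e (d + 2))

lemma TU {n d : ℕ} {e f : Fin n × Fin 2} {p q : Sym2 (VV n d)} (hp : T e p) (hq : U f q)
    (h : ∃ z, z ∈ p ∧ z ∈ q) : False := by
  obtain ⟨z, h1, h2⟩ := h
  obtain ⟨y, -, rfl⟩ := hq
  rw [Sym2.mem_iff] at h2
  rcases hp with rfl | rfl <;> rw [Sym2.mem_iff] at h1 <;>
  rcases h1 with rfl | rfl <;> simp only [D_ne_inl, false_or] at h2 <;>
  rw [D_inj (by omega) (by omega)] at h2 <;> omega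

lemma TT {n d : ℕ} {e f : Fin n × Fin 2} {p q : Sym2 (VV n d)} (hp : T e p) (hq : T f q)
    (h : ∃ z, z ∈ p ∧ z ∈ q) : e = f := by
  obtain ⟨z, h1, h2⟩ := h
  rcases hp with rfl | rfl <;> rcases hq with rfl | rfl <;> rw [Sym2.mem_iff] at h1 h2 <;>
  rcases h1 with rfl | rfl <;> rcases h2 with h2 | h2 <;>
  rw [D_inj (by omega) (by omega)] at h2 <;> exact h2.1

section
variable {n n' d : ℕ} {F : VV n d → VV n d → Sym2 (VV n' d)}

/-- the edges at the tail of each dragon go to tails of a dragon -/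
def Tails (F : VV n d → VV n d → Sym2 (VV n' d)) : Prop :=
  ∀ e : Fin n × Fin 2, ∃ e' : Fin n' × Fin 2, T e' (F (D e (d + 1)) (D e 0)) ∧
    T e' (F (D e (d + 1)) (D e d))

lemma c_edge (hd : 3 ≤ d) (hF : LH (sunletIndicator n d) (sunletIndicator n' d) F)
    {e : Fin n × Fin 2} {e' : Fin n' × Fin 2} (h0 : T e' (F (D e (d + 1)) (D e 0)))
    (h1 : T e' (F (D e (d + 1)) (D e d))) :
    F (D e (d + 2)) (D e (d + 1)) = s(D e' (d + 2), D e' (d + 1)) := by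
  have a0 : (sunletIndicator n d).Adj (D e (d + 1)) (D e 0) := (adj_r hd).2 (by simp)
  have a1 : (sunletIndicator n d).Adj (D e (d + 1)) (D e d) := (adj_r hd).2 (by simp)
  have a2 : (sunletIndicator n d).Adj (D e (d + 1)) (D e (d + 2)) := (adj_r hd).2 (by simp)
  have n01 : (D e 0 : VV n d) ≠ D e d := by
    rw [Ne, D_inj (by omega) (by omega)]; omega
  have n02 : (D e 0 : VV n d) ≠ D e (d + 2) := by
    rw [Ne, D_inj (by omega) (by omega)]; omega
  have n12 : (D e d : VV n d) ≠ D e (d + 2) := by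
    rw [Ne, D_inj (by omega) (by omega)]; omega
  obtain ⟨k01, -⟩ := hF.adj _ _ _ a0 a1 n01
  obtain ⟨k02, z0, z00, z02⟩ := hF.adj _ _ _ a0 a2 n02
  obtain ⟨k12, z1, z11, z12⟩ := hF.adj _ _ _ a1 a2 n12
  have hm := hF.mem _ _ a2
  rw [hF.symm]
  generalize F (D e (d + 1)) (D e (d + 2)) = P at *
  generalize F (D e (d + 1)) (D e 0) = A at *
  generalize F (D e (d + 1)) (D e d) = B at *
  have key : ∀ A B : Sym2 (VV n' d), A = s(D e' 0, D e' (d + 1)) → B = s(D e' d, D e' (d + 1)) →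
      A ≠ P → B ≠ P → (∃ z, z ∈ A ∧ z ∈ P) → (∃ z, z ∈ B ∧ z ∈ P) →
      P = s(D e' (d + 2), D e' (d + 1)) := by
    rintro _ _ rfl rfl hA hB ⟨z, hz, hzP⟩ ⟨w, hw, hwP⟩
    by_cases hr : D e' (d + 1) ∈ P
    · obtain ⟨y, hy, rfl⟩ := edge_mem hm hr
      rw [adj_r hd] at hy
      rcases hy with rfl | rfl | rfl
      · exact absurd Sym2.eq_swap hA
      · exact absurd Sym2.eq_swap hB
      · exact Sym2.eq_swap
    · exfalso
      rw [Sym2.mem_iff] at hz hw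
      rcases hz with rfl | rfl
      · rcases hw with rfl | rfl
        · have hne : (D e' 0 : VV n' d) ≠ D e' d := by
            rw [Ne, D_inj (by omega) (by omega)]; omega
          have := (Sym2.mem_and_mem_iff hne).1 ⟨hzP, hwP⟩
          subst this
          exact adj_0d hd hm
        · exact hr hwP
      · exact hr hzP
  rcases h0 with h0 | h0 <;> rcases h1 with h1 | h1
  · exact absurd (h0.trans h1.symm) k01
  · exact key A B h0 h1 k02 k12 ⟨z0, z00, z02⟩ ⟨z1, z11, z12⟩
  · exact key B A h1 h0 k12 k02 ⟨z1, z11, z12⟩ ⟨z0, z00, z02⟩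
  · exact absurd (h0.trans h1.symm) k01

lemma x_edge (hd : 3 ≤ d) (hF : LH (sunletIndicator n d) (sunletIndicator n' d) F)
    {e : Fin n × Fin 2} {e' : Fin n' × Fin 2} (h0 : T e' (F (D e (d + 1)) (D e 0)))
    (h1 : T e' (F (D e (d + 1)) (D e d))) {x} (hx : inc x e) :
    T e' (F (Sum.inl x) (D e (d + 2))) ∨ U e' (F (Sum.inl x) (D e (d + 2))) := by
  have hc := c_edge hd hF h0 h1
  have a0 : (sunletIndicator n d).Adj (D e (d + 2)) (D e (d + 1)) := adj_c.2 (by simp)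
  have a1 : (sunletIndicator n d).Adj (D e (d + 2)) (Sum.inl x) := adj_c.2 (Or.inr ⟨x, hx, rfl⟩)
  obtain ⟨hne, z, hz1, hz2⟩ := hF.adj _ _ _ a0 a1 D_ne_inl
  have hm := hF.mem _ _ a1
  rw [hc] at hz1 hne
  rw [hF.symm]
  generalize F (D e (d + 2)) (Sum.inl x) = P at *
  rw [Sym2.mem_iff] at hz1
  rcases hz1 with rfl | rfl
  · obtain ⟨y, hy, rfl⟩ := edge_mem hm hz2
    rw [adj_c] at hy
    rcases hy with rfl | ⟨y, hy, rfl⟩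
    · exact absurd rfl hne
    · exact Or.inr ⟨y, hy, Sym2.eq_swap⟩
  · obtain ⟨y, hy, rfl⟩ := edge_mem hm hz2
    rw [adj_r hd] at hy
    rcases hy with rfl | rfl | rfl
    · exact Or.inl (Or.inl Sym2.eq_swap)
    · exact Or.inl (Or.inr Sym2.eq_swap)
    · exact absurd Sym2.eq_swap hne

lemma TTT {e f g : Fin n × Fin 2} {p q r : Sym2 (VV n d)}
    (hp : T e p) (hq : T f q ∨ U f q) (hr : T g r ∨ U g r)
    (h1 : p ≠ q ∧ ∃ z, z ∈ p ∧ z ∈ q) (h2 : p ≠ r ∧ ∃ z, z ∈ p ∧ z ∈ r)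
    (h3 : q ≠ r ∧ ∃ z, z ∈ q ∧ z ∈ r) : False := by
  have hq' := hq.resolve_right (fun h => TU hp h h1.2)
  have hr' := hr.resolve_right (fun h => TU hp h h2.2)
  have := TT hp hq' h1.2
  subst this
  have := TT hp hr' h2.2
  subst this
  obtain ⟨h1, -⟩ := h1
  obtain ⟨h2, -⟩ := h2
  obtain ⟨h3, -⟩ := h3
  unfold T at *
  grind

lemma UU {e f : Fin n × Fin 2} {x y} (h : ∃ z : VV n d,
      z ∈ s(Sum.inl x, D e (d + 2)) ∧ z ∈ s(Sum.inl y, D f (d + 2))) : x = y ∨ e = f := by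
  obtain ⟨z, h1, h2⟩ := h
  rw [Sym2.mem_iff] at h1 h2
  rcases h1 with rfl | rfl
  · left
    simpa [inl_ne_D] using h2
  · right
    simp only [D_ne_inl, false_or] at h2
    rw [D_inj (by omega) (by omega)] at h2
    exact h2.1

lemma inc_three {e : Fin n × Fin 2} {x y z} (hx : inc x e) (hy : inc y e) (hz : inc z e)
    (h1 : x ≠ y) (h2 : x ≠ z) (h3 : y ≠ z) : False := by
  unfold inc at *
  rcases hx with rfl | ⟨a, j, hj, rfl⟩ | ⟨a, rfl⟩ <;>
  rcases hy with rfl | ⟨b, k, hk, rfl⟩ | ⟨b, rfl⟩ <;>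
  rcases hz with rfl | ⟨c, l, hl, rfl⟩ | ⟨c, rfl⟩ <;>
  simp only [ne_eq, Sum.inl.injEq, Sum.inr.injEq, Fin.ext_iff, not_true_eq_false, reduceCtorEq,
    not_false_eq_true] at h1 h2 h3 <;> omega

lemma inc_inr {i : Fin n} {e : Fin n × Fin 2} (h : inc (Sum.inr i) e) : e = (i, 1) := by
  unfold inc at h
  simp only [reduceCtorEq, and_false, exists_false, false_or, Sum.inr.injEq] at h
  ext
  · rw [h.2]
  · rw [h.1]; rfl

lemma cyc (hd : 3 ≤ d) (hF : LH (sunletIndicator n d) (sunletIndicator n' d) F)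
    (g : Fin n × Fin 2 → Fin n' × Fin 2)
    (hg : ∀ e, T (g e) (F (D e (d + 1)) (D e 0)) ∧ T (g e) (F (D e (d + 1)) (D e d)))
    {x} {e1 e2 e3 : Fin n × Fin 2} (h1 : inc x e1) (h2 : inc x e2) (h3 : inc x e3)
    (n12 : e1 ≠ e2) (n13 : e1 ≠ e3) (n23 : e2 ≠ e3) :
    ∃ i, (inc (Sum.inl i) (g e1) ∧
        F (Sum.inl x) (D e1 (d + 2)) = s(Sum.inl (Sum.inl i), D (g e1) (d + 2))) ∧
      (inc (Sum.inl i) (g e2) ∧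
        F (Sum.inl x) (D e2 (d + 2)) = s(Sum.inl (Sum.inl i), D (g e2) (d + 2))) ∧
      g e1 ≠ g e2 := by
  have adj : ∀ e, inc x e → (sunletIndicator n d).Adj (Sum.inl x) (D e (d + 2)) := by
    intro e he
    rw [adj_lD (by omega)]
    exact ⟨rfl, he⟩
  have dne : ∀ e f : Fin n × Fin 2, e ≠ f → (D e (d + 2) : VV n d) ≠ D f (d + 2) := by
    intro e f h
    rw [Ne, D_inj (by omega) (by omega)]
    exact fun h' => h h'.1
  have k12 := hF.adj _ _ _ (adj _ h1) (adj _ h2) (dne _ _ n12)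
  have k13 := hF.adj _ _ _ (adj _ h1) (adj _ h3) (dne _ _ n13)
  have k23 := hF.adj _ _ _ (adj _ h2) (adj _ h3) (dne _ _ n23)
  have sw : ∀ p q : Sym2 (VV n' d), (p ≠ q ∧ ∃ z, z ∈ p ∧ z ∈ q) →
      (q ≠ p ∧ ∃ z, z ∈ q ∧ z ∈ p) := fun p q h =>
    ⟨h.1.symm, let ⟨z, a, b⟩ := h.2; ⟨z, b, a⟩⟩
  have t1 := x_edge hd hF (hg e1).1 (hg e1).2 h1
  have t2 := x_edge hd hF (hg e2).1 (hg e2).2 h2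
  have t3 := x_edge hd hF (hg e3).1 (hg e3).2 h3
  have u1 := t1.resolve_left (fun h => TTT h t2 t3 k12 k13 k23)
  have u2 := t2.resolve_left (fun h => TTT h t1 t3 (sw _ _ k12) k23 k13)
  have u3 := t3.resolve_left (fun h => TTT h t1 t2 (sw _ _ k13) (sw _ _ k23) k12)
  obtain ⟨y1, i1, q1⟩ := u1
  obtain ⟨y2, i2, q2⟩ := u2
  obtain ⟨y3, i3, q3⟩ := u3
  rw [q1, q2] at k12
  rw [q1, q3] at k13
  rw [q2, q3] at k23
  have o12 := UU k12.2
  have o13 := UU k13.2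
  have o23 := UU k23.2
  have d12 : ¬ (y1 = y2 ∧ g e1 = g e2) := by
    rintro ⟨a, b⟩; exact k12.1 (by rw [a, b])
  have d13 : ¬ (y1 = y3 ∧ g e1 = g e3) := by
    rintro ⟨a, b⟩; exact k13.1 (by rw [a, b])
  have d23 : ¬ (y2 = y3 ∧ g e2 = g e3) := by
    rintro ⟨a, b⟩; exact k23.1 (by rw [a, b])
  have y12 : y1 = y2 := by
    by_contra hy
    have g12 := o12.resolve_left hy
    have g13 : g e1 = g e3 := by
      rcases o13 with h | h
      · rcases o23 with h' | h'
        · exact absurd (h.trans h'.symm) hy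
        · exact g12.trans h'
      · exact h
    have y13 : y1 ≠ y3 := fun h => d13 ⟨h, g13⟩
    have y23 : y2 ≠ y3 := fun h => d23 ⟨h, g12.symm.trans g13⟩
    rw [← g12] at i2
    rw [← g13] at i3
    exact inc_three i1 i2 i3 hy y13 y23
  subst y12
  have g12 : g e1 ≠ g e2 := fun h => d12 ⟨rfl, h⟩
  rcases y1 with i | i
  · exact ⟨i, ⟨i1, q1⟩, ⟨i2, q2⟩, g12⟩
  · exact absurd ((inc_inr i1).trans (inc_inr i2).symm) g12

lemma inc_two {i j : Fin n} {e : Fin n × Fin 2} (hi : inc (Sum.inl i) e) (hj : inc (Sum.inl j) e)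
    (h : i ≠ j) : e.2 = 0 ∧ ((i = e.1 ∧ j.val = (e.1.val + 1) % n) ∨
      (j = e.1 ∧ i.val = (e.1.val + 1) % n)) := by
  unfold inc at *
  simp only [Sum.inl.injEq, reduceCtorEq, and_false, or_false,
    Fin.ext_iff] at *
  rcases hi with hi | hi <;> rcases hj with hj | hj
  · omega
  · exact ⟨hj.1, Or.inl ⟨hi, by obtain ⟨_, a, b, c⟩ := hj; omega⟩⟩
  · exact ⟨hi.1, Or.inr ⟨hj, by obtain ⟨_, a, b, c⟩ := hi; omega⟩⟩
  · obtain ⟨_, a, b, c⟩ := hi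
    obtain ⟨_, a', b', c'⟩ := hj
    omega

lemma dvd_of_tails (hd : 3 ≤ d) (hn : 3 ≤ n)
    (hF : LH (sunletIndicator n d) (sunletIndicator n' d) F) (hT : Tails F) : n' ∣ n := by
  choose g hg using hT
  have hn0 : 0 < n := by omega
  let c : ℕ → Fin n := fun t => ⟨t % n, Nat.mod_lt _ hn0⟩
  let e : ℕ → Fin n × Fin 2 := fun t => (c t, 0)
  have incl : ∀ t, inc (Sum.inl (c t)) (e t) := fun t => Or.inl rfl
  have incr : ∀ t, inc (Sum.inl (c (t + 1))) (e t) := fun t =>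
    Or.inr (Or.inl ⟨rfl, c (t + 1), by simp [c, e], rfl⟩)
  have incp : ∀ t, inc (Sum.inl (c t)) (c t, 1) := fun t => Or.inl rfl
  have ene : ∀ t, e t ≠ e (t + 1) := by
    intro t h
    have := congrArg (fun p => p.1.val) h
    exact mod_ne (by omega) t this
  have epne : ∀ t u, e t ≠ (c u, 1) := by
    intro t u h
    have := congrArg (fun p => p.2.val) h
    simp [e] at this
  have H : ∀ t, ∃ i, (inc (Sum.inl i) (g (e t)) ∧
        F (Sum.inl (Sum.inl (c (t + 1)))) (D (e t) (d + 2))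
          = s(Sum.inl (Sum.inl i), D (g (e t)) (d + 2))) ∧
      (inc (Sum.inl i) (g (e (t + 1))) ∧
        F (Sum.inl (Sum.inl (c (t + 1)))) (D (e (t + 1)) (d + 2))
          = s(Sum.inl (Sum.inl i), D (g (e (t + 1))) (d + 2))) ∧
      g (e t) ≠ g (e (t + 1)) := by
    intro t
    exact cyc hd hF g hg (incr t) (incl (t + 1)) (incp (t + 1)) (ene t) (epne _ _) (epne _ _)
  choose ψ h1 h2 h3 using H
  -- `ψ t` is the image of `c (t+1)`
  have cper : ∀ t, c (t + n) = c t := by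
    intro t; simp [c]
  have ψne : ∀ t, ψ t ≠ ψ (t + 1) := by
    intro t h
    have a1 : (sunletIndicator n d).Adj (D (e (t + 1)) (d + 2)) (Sum.inl (Sum.inl (c (t + 1)))) :=
      adj_c.2 (Or.inr ⟨_, incl (t + 1), rfl⟩)
    have a2 : (sunletIndicator n d).Adj (D (e (t + 1)) (d + 2))
        (Sum.inl (Sum.inl (c (t + 1 + 1)))) :=
      adj_c.2 (Or.inr ⟨_, incr (t + 1), rfl⟩)
    have hne : (Sum.inl (Sum.inl (c (t + 1))) : VV n d) ≠ Sum.inl (Sum.inl (c (t + 1 + 1))) := by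
      intro h
      have h' := Sum.inl.inj (Sum.inl.inj h)
      exact mod_ne (by omega) (t + 1) (congrArg Fin.val h')
    have := (hF.adj _ _ _ a1 a2 hne).1
    rw [hF.symm, hF.symm _ (Sum.inl (Sum.inl (c (t + 1 + 1)))), (h2 t).2, (h1 (t + 1)).2, h] at this
    exact this rfl
  have step : ∀ t, (g (e (t + 1))).2 = 0 ∧
      ((ψ t = (g (e (t + 1))).1 ∧ (ψ (t + 1)).val = ((g (e (t + 1))).1.val + 1) % n') ∨
      (ψ (t + 1) = (g (e (t + 1))).1 ∧ (ψ t).val = ((g (e (t + 1))).1.val + 1) % n')) := fun t =>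
    inc_two (h2 t).1 (h1 (t + 1)).1 (ψne t)
  have per : ψ n = ψ 0 := by
    have e1 : e (n + 1) = e 1 := by simp only [e]; rw [add_comm n 1, cper]
    have e2 : c (n + 1) = c 1 := by rw [add_comm n 1, cper]
    have e3 := (h2 n).2
    have e4 := (h2 0).2
    simp only [zero_add] at e4
    rw [e1, e2, e4] at e3
    have := Sym2.congr_left.1 e3
    exact (Sum.inl.inj (Sum.inl.inj this)).symm
  have gne : ∀ t, (g (e (t + 1))).1 ≠ (g (e (t + 1 + 1))).1 := by
    intro t h
    exact h3 (t + 1) (Prod.ext h ((step t).1.trans (step (t + 1)).1.symm))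
  have inj : ∀ i j : Fin n', (i.val + 1) % n' = (j.val + 1) % n' → i = j := by
    intro i j h
    have h5 : i.val ≡ j.val [MOD n'] := Nat.ModEq.add_right_cancel' 1 h
    have h6 : i.val % n' = j.val % n' := h5
    rw [Nat.mod_eq_of_lt i.isLt, Nat.mod_eq_of_lt j.isLt] at h6
    exact Fin.ext h6
  rcases (step 0).2 with h0 | h0
  · have all : ∀ t, ψ t = (g (e (t + 1))).1 ∧ (ψ (t + 1)).val = ((g (e (t + 1))).1.val + 1) % n' := by
      intro t
      induction t with
      | zero => exact h0
      | succ t ih =>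
        rcases (step (t + 1)).2 with h | h
        · exact h
        · exact absurd (inj _ _ (ih.2.symm.trans h.2)) (gne t)
    have mod : ∀ t, (ψ t).val ≡ (ψ 0).val + t [MOD n'] := by
      intro t
      induction t with
      | zero => rfl
      | succ t ih =>
        have h := all t
        rw [← h.1] at h
        have h5 : (ψ (t + 1)).val ≡ (ψ t).val + 1 [MOD n'] := by
          rw [h.2]; exact Nat.mod_modEq _ _
        exact h5.trans (ih.add_right 1)
    have := mod n
    rw [per] at this
    have h6 : (ψ 0).val + 0 ≡ (ψ 0).val + n [MOD n'] := this
    have h7 := Nat.ModEq.add_left_cancel' _ h6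
    exact (Nat.modEq_zero_iff_dvd).1 h7.symm
  · have all : ∀ t, ψ (t + 1) = (g (e (t + 1))).1 ∧ (ψ t).val = ((g (e (t + 1))).1.val + 1) % n' := by
      intro t
      induction t with
      | zero => exact h0
      | succ t ih =>
        rcases (step (t + 1)).2 with h | h
        · exact absurd (ih.1.symm.trans h.1) (gne t)
        · exact h
    have mod : ∀ t, (ψ t).val + t ≡ (ψ 0).val [MOD n'] := by
      intro t
      induction t with
      | zero => rfl
      | succ t ih =>
        have h := all t
        rw [← h.1] at h
        have h5 : (ψ t).val ≡ (ψ (t + 1)).val + 1 [MOD n'] := by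
          rw [h.2]; exact Nat.mod_modEq _ _
        have h6 := h5.add_right t
        have h7 := h6.symm.trans ih
        rw [add_assoc, add_comm 1 t] at h7
        exact h7
    have := mod n
    rw [per] at this
    have h6 : (ψ 0).val + n ≡ (ψ 0).val + 0 [MOD n'] := this
    have h7 := Nat.ModEq.add_left_cancel' _ h6
    exact (Nat.modEq_zero_iff_dvd).1 h7

end

end SunHom
namespace SunHom

lemma clique4 {ι V : Type*} [DecidableEq ι] (N : Finset ι) (h4 : 4 ≤ N.card) (E : ι → Sym2 V)
    (nd : ∀ i ∈ N, ¬ (E i).IsDiag)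
    (h : ∀ i ∈ N, ∀ j ∈ N, i ≠ j → E i ≠ E j ∧ ∃ z, z ∈ E i ∧ z ∈ E j) :
    ∃ z, ∀ i ∈ N, z ∈ E i := by
  obtain ⟨i, hi, j, hj, hij⟩ := Finset.one_lt_card.1 (by omega : 1 < N.card)
  obtain ⟨hne, a, hai, haj⟩ := h i hi j hj hij
  by_contra hcon
  push Not at hcon
  obtain ⟨k, hk, hak⟩ := hcon a
  have hki : k ≠ i := by rintro rfl; exact hak hai
  have hkj : k ≠ j := by rintro rfl; exact hak haj
  obtain ⟨l, hl, hl'⟩ : ∃ l ∈ N, l ∉ ({i, j, k} : Finset ι) := by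
    apply Finset.exists_mem_notMem_of_card_lt_card
    have := Finset.card_le_three (a := i) (b := j) (c := k)
    omega
  simp only [Finset.mem_insert, Finset.mem_singleton, not_or] at hl'
  obtain ⟨hli, hlj, hlk⟩ := hl'
  have hki' := h k hk i hi hki
  have hkj' := h k hk j hj hkj
  have hli' := h l hl i hi hli
  have hlj' := h l hl j hj hlj
  have hlk' := h l hl k hk hlk
  have ndi := nd i hi
  have ndj := nd j hj
  have ndk := nd k hk
  have ndl := nd l hl
  generalize E i = P at *
  generalize E j = Q at *
  generalize E k = R at *
  generalize E l = S at *
  obtain ⟨b, rfl⟩ := hai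
  obtain ⟨c, rfl⟩ := haj
  induction R using Sym2.ind with | _ r1 r2 =>
  induction S using Sym2.ind with | _ s1 s2 =>
  simp only [Sym2.mem_iff, Sym2.mk_isDiag_iff, Sym2.eq_iff, ne_eq] at *
  grind

def Nb (d k : ℕ) : Finset ℕ := (Finset.range (d + 2)).filter (fun l => IR d k l)

lemma mem_Nb {d k l : ℕ} : l ∈ Nb d k ↔ l < d + 2 ∧ IR d k l := by
  simp [Nb]

lemma card_Nb {d k : ℕ} (hd : 3 ≤ d) (hk : k ≤ d) : (Nb d k).card = d := by
  by_cases h : k = 0 ∨ k = d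
  · have : Nb d k = ((Finset.range (d + 2)).erase 0).erase d := by
      ext l
      simp only [mem_Nb, Finset.mem_erase, Finset.mem_range]
      unfold IR
      omega
    rw [this, Finset.card_erase_of_mem, Finset.card_erase_of_mem, Finset.card_range]
    · omega
    · simp
    · simp; omega
  · have : Nb d k = (Finset.range (d + 1)).erase k := by
      ext l
      simp only [mem_Nb, Finset.mem_erase, Finset.mem_range]
      unfold IR
      omega
    rw [this, Finset.card_erase_of_mem, Finset.card_range]
    · omega
    · simp; omega

lemma even_of_inv (m : ℕ) (p : ℕ → ℕ) (h1 : ∀ k < m, p k < m) (h2 : ∀ k < m, p k ≠ k)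
    (h3 : ∀ k < m, p (p k) = k) : Even m := by
  have := Finset.sum_involution (s := Finset.range m) (f := fun _ => (1 : ZMod 2))
    (fun k _ => p k) (fun _ _ => by decide) (fun k hk _ => h2 k (Finset.mem_range.1 hk))
    (fun k hk => Finset.mem_range.2 (h1 k (Finset.mem_range.1 hk)))
    (fun k hk => h3 k (Finset.mem_range.1 hk))
  simp only [Finset.sum_const, Finset.card_range, nsmul_eq_mul, mul_one] at this
  rwa [ZMod.natCast_eq_zero_iff_even] at this

lemma IR_symm {d k l : ℕ} : IR d k l ↔ IR d l k := by
  unfold IR; omega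

lemma IR_irr {d k : ℕ} : ¬ IR d k k := by
  unfold IR; omega

lemma parity {C : Type*} [DecidableEq C] {d : ℕ} (hd : 3 ≤ d) (col : ℕ → ℕ → C)
    (symm : ∀ k l, col k l = col l k) (S : Finset C) (hS : S.card = d)
    (star : ∀ k ≤ d, (Nb d k).image (col k) = S)
    (hne : col 0 (d + 1) ≠ col d (d + 1)) : False := by
  have inj : ∀ k ≤ d, Set.InjOn (col k) (Nb d k) := by
    intro k hk
    apply Finset.card_image_iff.1
    rw [star k hk, hS, card_Nb hd hk]
  have ex : ∀ y ∈ S, ∀ k, ∃ l, k ≤ d → l ∈ Nb d k ∧ col k l = y := by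
    intro y hy k
    by_cases hk : k ≤ d
    · rw [← star k hk, Finset.mem_image] at hy
      obtain ⟨l, h⟩ := hy
      exact ⟨l, fun _ => h⟩
    · exact ⟨0, fun h => absurd h hk⟩
  have m0 : d + 1 ∈ Nb d 0 := by rw [mem_Nb]; unfold IR; omega
  have md : d + 1 ∈ Nb d d := by rw [mem_Nb]; unfold IR; omega
  have back : ∀ k l, k ≤ d → l ∈ Nb d k → k ∈ Nb d l := by
    intro k l hk hl
    rw [mem_Nb] at *
    exact ⟨by omega, IR_symm.1 hl.2⟩
  have tail : ∀ k, k ≤ d → d + 1 ∈ Nb d k → k = 0 ∨ k = d := by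
    intro k hk h
    rw [mem_Nb] at h; unfold IR at h; omega
  -- colour present at the tail
  have E0 : Even (d + 2) := by
    have hy : col 0 (d + 1) ∈ S := by
      rw [← star 0 (by omega)]; exact Finset.mem_image_of_mem _ m0
    choose p hp using ex _ hy
    have p0 : p 0 = d + 1 :=
      inj 0 (by omega) (hp 0 (by omega)).1 m0 (hp 0 (by omega)).2
    have plt : ∀ k, k ≤ d → k ≠ 0 → p k ≤ d := by
      intro k hk hk0
      have h := hp k hk
      by_contra hcon
      have h1 := (mem_Nb.1 h.1).1
      have h2 : p k = d + 1 := by omega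
      rw [h2] at h
      rcases tail k hk h.1 with rfl | rfl
      · exact hk0 rfl
      · exact hne h.2.symm
    refine even_of_inv (d + 2) (fun k => if k = d + 1 then 0 else p k) ?_ ?_ ?_
    · intro k hk
      split_ifs with h
      · omega
      · exact (mem_Nb.1 (hp k (by omega)).1).1
    · intro k hk
      split_ifs with h
      · omega
      · intro h'
        have := (mem_Nb.1 (hp k (by omega)).1).2
        rw [h'] at this
        exact IR_irr this
    · intro k hk
      by_cases h : k = d + 1
      · subst h
        simp [p0]
      · by_cases h0 : k = 0
        · subst h0
          simp [p0]
        · have hk' : k ≤ d := by omega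
          have h1 := plt k hk' h0
          rw [if_neg h, if_neg (by omega)]
          refine inj (p k) h1 (hp _ h1).1 (back _ _ hk' (hp k hk').1) ?_
          exact (hp _ h1).2.trans ((hp k hk').2.symm.trans (symm _ _))
  have E1 : Even (d + 1) := by
    obtain ⟨y, hy, hy'⟩ : ∃ y ∈ S, y ∉ ({col 0 (d + 1), col d (d + 1)} : Finset C) := by
      apply Finset.exists_mem_notMem_of_card_lt_card
      have := Finset.card_le_two (a := col 0 (d + 1)) (b := col d (d + 1))
      omega
    simp only [Finset.mem_insert, Finset.mem_singleton, not_or] at hy'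
    choose p hp using ex _ hy
    have plt : ∀ k, k ≤ d → p k ≤ d := by
      intro k hk
      have h := hp k hk
      by_contra hcon
      have h1 := (mem_Nb.1 h.1).1
      have h2 : p k = d + 1 := by omega
      rw [h2] at h
      rcases tail k hk h.1 with rfl | rfl
      · exact hy'.1 h.2.symm
      · exact hy'.2 h.2.symm
    refine even_of_inv (d + 1) p ?_ ?_ ?_
    · intro k hk
      have := plt k (by omega)
      omega
    · intro k hk h'
      have := (mem_Nb.1 (hp k (by omega)).1).2
      rw [h'] at this
      exact IR_irr this
    · intro k hk
      have hk' : k ≤ d := by omega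
      have h1 := plt k hk'
      refine inj (p k) h1 (hp _ h1).1 (back _ _ hk' (hp k hk').1) ?_
      exact (hp _ h1).2.trans ((hp k hk').2.symm.trans (symm _ _))
  rcases E0 with ⟨a, ha⟩
  rcases E1 with ⟨b, hb⟩
  omega

lemma adj_body {n d : ℕ} {e : Fin n × Fin 2} {k : ℕ} (hk : k ≤ d) {y : VV n d} :
    (sunletIndicator n d).Adj (D e k) y ↔ ∃ l ∈ Nb d k, y = D e l := by
  rcases V_cases y with ⟨x, rfl⟩ | ⟨e', l, hl, rfl⟩
  · rw [adj_Dl (by omega)]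
    simp only [inl_ne_D, and_false, exists_false, iff_false]
    omega
  · rw [adj_DD (by omega) hl]
    constructor
    · rintro ⟨rfl, h⟩
      refine ⟨l, ?_, rfl⟩
      rw [mem_Nb]
      refine ⟨?_, h⟩
      unfold IR at h; omega
    · rintro ⟨m, hm, h⟩
      rw [mem_Nb] at hm
      rw [D_inj hl (by omega)] at h
      obtain ⟨rfl, rfl⟩ := h
      exact ⟨rfl, hm.2⟩

lemma inc_inl {n : ℕ} {i : Fin n} {e : Fin n × Fin 2} (h : inc (Sum.inl i) e) :
    e = (i, 0) ∨ e = (i, 1) ∨ (e.2 = 0 ∧ i.val = (e.1.val + 1) % n) := by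
  unfold inc at h
  simp only [Sum.inl.injEq, reduceCtorEq, and_false, or_false] at h
  rcases h with rfl | ⟨h1, j, hj, rfl⟩
  · obtain ⟨i, b⟩ := e
    fin_cases b <;> simp
  · right; right
    exact ⟨Fin.ext h1, hj⟩

lemma deg_le {n d : ℕ} (hd : 3 ≤ d) (z : VV n d) (N : Finset (VV n d))
    (hN : ∀ y ∈ N, (sunletIndicator n d).Adj z y) :
    N.card ≤ 3 ∨ ∃ e k, k ≤ d ∧ z = D e k ∧ N.card ≤ d := by
  classical
  rcases V_cases z with ⟨x, rfl⟩ | ⟨e, k, hk, rfl⟩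
  · left
    rcases x with i | i
    · by_cases hj : ∃ j : Fin n, i.val = (j.val + 1) % n
      · obtain ⟨j, hj⟩ := hj
        have : N ⊆ {D (i, 0) (d + 2), D (i, 1) (d + 2), D (j, 0) (d + 2)} := by
          intro y hy
          have h := hN y hy
          rcases V_cases y with ⟨x, rfl⟩ | ⟨e, k, hk, rfl⟩
          · exact absurd h adj_ll
          · rw [adj_lD hk] at h
            obtain ⟨rfl, h⟩ := h
            simp only [Finset.mem_insert, Finset.mem_singleton, D_inj hk hk, and_true]
            rcases inc_inl h with h | h | ⟨h, h'⟩
            · simp [h]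
            · simp [h]
            · right; right
              ext
              · have h4 : e.1.val + 1 ≡ j.val + 1 [MOD n] := h'.symm.trans hj
                have h5 : e.1.val ≡ j.val [MOD n] := Nat.ModEq.add_right_cancel' 1 h4
                have h6 : e.1.val % n = j.val % n := h5
                rwa [Nat.mod_eq_of_lt e.1.isLt, Nat.mod_eq_of_lt j.isLt] at h6
              · simp [h]
        exact (Finset.card_le_card this).trans Finset.card_le_three
      · have : N ⊆ {D (i, 0) (d + 2), D (i, 1) (d + 2)} := by
          intro y hy
          have h := hN y hy
          rcases V_cases y with ⟨x, rfl⟩ | ⟨e, k, hk, rfl⟩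
          · exact absurd h adj_ll
          · rw [adj_lD hk] at h
            obtain ⟨rfl, h⟩ := h
            simp only [Finset.mem_insert, Finset.mem_singleton, D_inj hk hk, and_true]
            rcases inc_inl h with h | h | ⟨h, h'⟩
            · simp [h]
            · simp [h]
            · exact absurd ⟨_, h'⟩ hj
        exact ((Finset.card_le_card this).trans Finset.card_le_two).trans (by omega)
    · have : N ⊆ {D (i, 1) (d + 2)} := by
        intro y hy
        have h := hN y hy
        rcases V_cases y with ⟨x, rfl⟩ | ⟨e, k, hk, rfl⟩
        · exact absurd h adj_ll
        · rw [adj_lD hk] at h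
          obtain ⟨rfl, h⟩ := h
          rw [inc_inr h]
          simp
      have := Finset.card_le_card this
      simp at this
      omega
  · by_cases h1 : k = d + 1
    · left
      subst h1
      have : N ⊆ {D e 0, D e d, D e (d + 2)} := by
        intro y hy
        have h := (adj_r hd).1 (hN y hy)
        simpa using h
      exact (Finset.card_le_card this).trans Finset.card_le_three
    · by_cases h2 : k = d + 2
      · left
        subst h2
        by_contra hcon
        push Not at hcon
        have h3 : 2 < (N.erase (D e (d + 1))).card := by
          have := Finset.pred_card_le_card_erase (s := N) (a := D e (d + 1))
          omega
        obtain ⟨a, ha, b, hb, c, hc, hab, hac, hbc⟩ := Finset.two_lt_card.1 h3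
        have key : ∀ y ∈ N.erase (D e (d + 1)), ∃ x, inc x e ∧ y = Sum.inl x := by
          intro y hy
          rw [Finset.mem_erase] at hy
          exact (adj_c.1 (hN y hy.2)).resolve_left hy.1
        obtain ⟨x, hx, rfl⟩ := key a ha
        obtain ⟨y, hy, rfl⟩ := key b hb
        obtain ⟨z, hz, rfl⟩ := key c hc
        exact inc_three hx hy hz (fun h => hab (by rw [h])) (fun h => hac (by rw [h]))
          (fun h => hbc (by rw [h]))
      · right
        refine ⟨e, k, by omega, rfl, ?_⟩
        have : N ⊆ (Nb d k).image (D e) := by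
          intro y hy
          have h := (adj_body (by omega)).1 (hN y hy)
          rw [Finset.mem_image]
          obtain ⟨l, hl, rfl⟩ := h
          exact ⟨l, hl, rfl⟩
        calc N.card ≤ _ := Finset.card_le_card this
          _ ≤ (Nb d k).card := Finset.card_image_le
          _ = d := card_Nb hd (by omega)

end SunHom
namespace SunHom

section
variable {n n' d : ℕ} {F : VV n d → VV n d → Sym2 (VV n' d)}

lemma not_diag {V : Type*} {G : SimpleGraph V} {p : Sym2 V} (h : p ∈ G.edgeSet) : ¬ p.IsDiag :=
  G.not_isDiag_of_mem_edgeSet h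

lemma star_image (hd : 4 ≤ d) (hF : LH (sunletIndicator n d) (sunletIndicator n' d) F)
    (e : Fin n × Fin 2) (k : ℕ) (hk : k ≤ d) : ∃ (e' : Fin n' × Fin 2) (m : ℕ), m ≤ d ∧
      (∀ l ∈ Nb d k, D e' m ∈ F (D e k) (D e l)) ∧
      (open Classical in (Nb d k).image (fun l => F (D e k) (D e l)) =
        (Nb d m).image (fun l => s(D e' m, D e' l))) := by
  classical
  have adj : ∀ l ∈ Nb d k, (sunletIndicator n d).Adj (D e k) (D e l) := by
    intro l hl
    exact (adj_body hk).2 ⟨l, hl, rfl⟩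
  have ne : ∀ l ∈ Nb d k, ∀ l' ∈ Nb d k, l ≠ l' → (D e l : VV n d) ≠ D e l' := by
    intro l hl l' hl' h h'
    rw [mem_Nb] at hl hl'
    rw [D_inj (by omega) (by omega)] at h'
    exact h h'.2
  obtain ⟨z, hz⟩ := clique4 (Nb d k) (by rw [card_Nb (by omega) hk]; exact hd)
    (fun l => F (D e k) (D e l)) (fun l hl => not_diag (hF.mem _ _ (adj l hl)))
    (fun l hl l' hl' h => hF.adj _ _ _ (adj l hl) (adj l' hl') (ne l hl l' hl' h))
  have ex : ∀ l, ∃ y, l ∈ Nb d k → (sunletIndicator n' d).Adj z y ∧ F (D e k) (D e l) = s(z, y) := by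
    intro l
    by_cases hl : l ∈ Nb d k
    · obtain ⟨y, hy⟩ := edge_mem (hF.mem _ _ (adj l hl)) (hz l hl)
      exact ⟨y, fun _ => hy⟩
    · exact ⟨z, fun h => absurd h hl⟩
  choose y hy using ex
  have inj : Set.InjOn (fun l => F (D e k) (D e l)) (Nb d k) := by
    intro l hl l' hl' h
    by_contra hne
    exact (hF.adj _ _ _ (adj l hl) (adj l' hl') (ne l hl l' hl' hne)).1 h
  have yinj : Set.InjOn y (Nb d k) := by
    intro l hl l' hl' h
    apply inj hl hl'
    simp only
    rw [(hy l hl).2, (hy l' hl').2, h]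
  have hc : ((Nb d k).image y).card = d := by
    rw [Finset.card_image_of_injOn yinj, card_Nb (by omega) hk]
  rcases deg_le (by omega) z ((Nb d k).image y) (by
    intro w hw
    rw [Finset.mem_image] at hw
    obtain ⟨l, hl, rfl⟩ := hw
    exact (hy l hl).1) with h | ⟨e', m, hm, rfl, -⟩
  · omega
  refine ⟨e', m, hm, hz, ?_⟩
  apply Finset.eq_of_subset_of_card_le
  · intro p hp
    rw [Finset.mem_image] at hp ⊢
    obtain ⟨l, hl, rfl⟩ := hp
    obtain ⟨h1, h2⟩ := hy l hl
    obtain ⟨l', hl', h3⟩ := (adj_body hm).1 h1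
    exact ⟨l', hl', by rw [h2, h3]⟩
  · rw [Finset.card_image_of_injOn inj, card_Nb (by omega) hk]
    exact Finset.card_image_le.trans (card_Nb (by omega) hm).le

lemma adj_body' {e : Fin n × Fin 2} {k l : ℕ} (hk : k ≤ d) (hl : l ≤ d) (hne : k ≠ l)
    (h1 : ¬ (k = 0 ∧ l = d)) (h2 : ¬ (k = d ∧ l = 0)) :
    (sunletIndicator n d).Adj (D e k) (D e l) := by
  rw [adj_DD (by omega) (by omega)]
  refine ⟨rfl, ?_⟩
  unfold IR; omega

/-- `k`, `l` adjacent in the body of the dragon -/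
def B (d k l : ℕ) : Prop := k ≤ d ∧ l ≤ d ∧ k ≠ l ∧ ¬ (k = 0 ∧ l = d) ∧ ¬ (k = d ∧ l = 0)

lemma B_Nb {k l : ℕ} (h : B d k l) : l ∈ Nb d k := by
  rw [mem_Nb]; unfold B at h; unfold IR; omega

lemma B_symm {k l : ℕ} (h : B d k l) : B d l k := by
  unfold B at *; omega

lemma B_adj {k l : ℕ} (e : Fin n × Fin 2) (h : B d k l) :
    (sunletIndicator n d).Adj (D e k) (D e l) :=
  adj_body' h.1 h.2.1 h.2.2.1 h.2.2.2.1 h.2.2.2.2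

lemma pair_eq {V : Type*} {a b : V} {p : Sym2 V} (h : a ≠ b) (ha : a ∈ p) (hb : b ∈ p) :
    p = s(a, b) := (Sym2.mem_and_mem_iff h).1 ⟨ha, hb⟩

lemma tails_ge4 (hd : 4 ≤ d) (hF : LH (sunletIndicator n d) (sunletIndicator n' d) F) :
    Tails F := by
  classical
  intro e
  have H := star_image hd hF e
  have H' : ∀ k, ∃ (e' : Fin n' × Fin 2) (m : ℕ), k ≤ d → (m ≤ d ∧
      (∀ l ∈ Nb d k, D e' m ∈ F (D e k) (D e l)) ∧
      ((Nb d k).image (fun l => F (D e k) (D e l)) =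
        (Nb d m).image (fun l => s(D e' m, D e' l)))) := by
    intro k
    by_cases hk : k ≤ d
    · obtain ⟨e', m, h1, h2, h3⟩ := H k hk
      refine ⟨e', m, fun _ => ⟨h1, h2, ?_⟩⟩
      convert h3
    · obtain ⟨e', m, h1, h2, h3⟩ := H 0 (by omega)
      exact ⟨e', m, fun h => absurd h hk⟩
  choose E m h using H'
  have hm : ∀ k, k ≤ d → m k ≤ d := fun k hk => (h k hk).1
  have hmem : ∀ k, k ≤ d → ∀ l ∈ Nb d k, D (E k) (m k) ∈ F (D e k) (D e l) :=
    fun k hk => (h k hk).2.1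
  have himg := fun k hk => (h k hk).2.2
  clear h H
  let φ : ℕ → VV n' d := fun k => D (E k) (m k)
  have φi : ∀ k l, k ≤ d → l ≤ d → (φ k = φ l ↔ E k = E l ∧ m k = m l) := by
    intro k l hk hl
    have h1 := hm k hk
    have h2 := hm l hl
    exact D_inj (by omega) (by omega)
  have Dne : ∀ k l, k ≤ d + 2 → l ≤ d + 2 → k ≠ l → (D e k : VV n d) ≠ D e l := by
    intro k l hk hl hne h
    rw [D_inj (by omega) (by omega)] at h
    exact hne h.2
  have Feq : ∀ k l, B d k l → φ k ≠ φ l → F (D e k) (D e l) = s(φ k, φ l) := by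
    intro k l hB hne
    refine pair_eq hne (hmem k hB.1 l (B_Nb hB)) ?_
    rw [hF.symm]
    exact hmem l hB.2.1 k (B_Nb (B_symm hB))
  -- collapse propagates along triangles
  have prop : ∀ k l x, B d k l → B d k x → B d l x → φ k = φ l → φ x = φ k := by
    intro k l x h1 h2 h3 heq
    by_contra hne
    have a := Feq k x h2 (fun h => hne h.symm)
    have b := Feq l x h3 (fun h => hne (h.symm.trans heq.symm))
    rw [← heq] at b
    refine (hF.adj (D e x) (D e k) (D e l) (B_adj e (B_symm h2)) (B_adj e (B_symm h3))
      (Dne _ _ (by have := h1.1; omega) (by have := h1.2.1; omega) h1.2.2.1)).1 ?_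
    rw [hF.symm, a, hF.symm, b]
  have r0 : (sunletIndicator n d).Adj (D e (d + 1)) (D e 0) := (adj_r (by omega)).2 (by simp)
  have rd : (sunletIndicator n d).Adj (D e (d + 1)) (D e d) := (adj_r (by omega)).2 (by simp)
  have m0 : d + 1 ∈ Nb d 0 := by rw [mem_Nb]; unfold IR; omega
  have md : d + 1 ∈ Nb d d := by rw [mem_Nb]; unfold IR; omega
  by_cases hcol : ∃ k l, B d k l ∧ φ k = φ l
  · exfalso
    obtain ⟨k, l, hB, heq⟩ := hcol
    have all12 : φ 1 = φ 2 := by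
      -- reduce to the edge {1,2}
      have s1 : ∀ k l, B d k l → φ k = φ l → ∀ x, 1 ≤ x → x < d → φ x = φ k := by
        intro k l hB heq x hx1 hx2
        by_cases hxk : x = k
        · rw [hxk]
        · by_cases hxl : x = l
          · rw [hxl, heq]
          · exact prop k l x hB (by unfold B at *; omega) (by unfold B at *; omega) heq
      rw [s1 k l hB heq 1 (by omega) (by omega), s1 k l hB heq 2 (by omega) (by omega)]
    have all : ∀ x, x ≤ d → φ x = φ 1 := by
      intro x hx
      by_cases h1 : x = 1
      · rw [h1]
      · by_cases h2 : x = 2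
        · rw [h2, all12]
        · exact prop 1 2 x (by unfold B; omega) (by unfold B; omega) (by unfold B; omega) all12
    have same : ∀ x, x ≤ d → E x = E 1 ∧ m x = m 1 := fun x hx =>
      (φi x 1 hx (by omega)).1 (all x hx)
    refine parity (d := d) (by omega) (fun k l => F (D e k) (D e l)) (fun k l => hF.symm _ _)
      ((Nb d (m 1)).image (fun l => s(D (E 1) (m 1), D (E 1) l))) ?_ ?_ ?_
    · rw [Finset.card_image_of_injOn, card_Nb (by omega) (hm 1 (by omega))]
      intro a ha b hb hab
      have := Sym2.congr_right.1 hab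
      rw [Finset.mem_coe, mem_Nb] at ha hb
      rw [D_inj (by omega) (by omega)] at this
      exact this.2
    · intro k hk
      have := himg k hk
      rw [(same k hk).1, (same k hk).2] at this
      exact this
    · have := (hF.adj _ _ _ r0 rd (Dne _ _ (by omega) (by omega) (by omega))).1
      intro h
      apply this
      rw [hF.symm, h, hF.symm]
  · push Not at hcol
    have Fe : ∀ k l, B d k l → F (D e k) (D e l) = s(φ k, φ l) := fun k l h =>
      Feq k l h (hcol k l h)
    have φadj : ∀ k l, B d k l → E k = E l ∧ IR d (m k) (m l) := by
      intro k l h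
      have h1 := hF.mem _ _ (B_adj e h)
      rw [Fe k l h] at h1
      have h2 : (sunletIndicator n' d).Adj (φ k) (φ l) := h1
      have h3 := hm k h.1
      have h4 := hm l h.2.1
      exact (adj_DD (by omega) (by omega)).1 h2
    have same : ∀ k, k ≤ d → E k = E 1 := by
      intro k hk
      by_cases h1 : k = 1
      · rw [h1]
      · exact (φadj k 1 (by unfold B; omega)).1
    have n0d : φ 0 ≠ φ d := by
      intro h
      have b1 : B d 1 0 := by unfold B; omega
      have b2 : B d 1 d := by unfold B; omega
      refine (hF.adj _ _ _ (B_adj e b1) (B_adj e b2) (Dne _ _ (by omega) (by omega) (by omega))).1 ?_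
      rw [Fe _ _ b1, Fe _ _ b2, h]
    have minj : ∀ k l, k ≤ d → l ≤ d → m k = m l → k = l := by
      intro k l hk hl hkl
      by_contra hne
      have heq : φ k = φ l := (φi k l hk hl).2 ⟨(same k hk).trans (same l hl).symm, hkl⟩
      by_cases hB : B d k l
      · exact hcol k l hB heq
      · have : (k = 0 ∧ l = d) ∨ (k = d ∧ l = 0) := by
          unfold B at hB; omega
        rcases this with ⟨rfl, rfl⟩ | ⟨rfl, rfl⟩
        · exact n0d heq
        · exact n0d heq.symm
    have msurj : ∀ j, j ≤ d → ∃ k, k ≤ d ∧ m k = j := by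
      intro j hj
      have himg : (Finset.range (d + 1)).image m = Finset.range (d + 1) := by
        apply Finset.eq_of_subset_of_card_le
        · intro x hx
          rw [Finset.mem_image] at hx
          obtain ⟨k, hk, rfl⟩ := hx
          rw [Finset.mem_range] at *
          have := hm k (by omega)
          omega
        · rw [Finset.card_image_of_injOn]
          intro a ha b hb hab
          rw [Finset.mem_coe, Finset.mem_range] at *
          exact minj a b (by omega) (by omega) hab
      have : j ∈ (Finset.range (d + 1)).image m := by
        rw [himg, Finset.mem_range]; omega
      rw [Finset.mem_image] at this
      obtain ⟨k, hk, rfl⟩ := this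
      rw [Finset.mem_range] at hk
      exact ⟨k, by omega, rfl⟩
    have ends : (m 0 = 0 ∧ m d = d) ∨ (m 0 = d ∧ m d = 0) := by
      obtain ⟨k, hk, hk'⟩ := msurj 0 (by omega)
      obtain ⟨l, hl, hl'⟩ := msurj d (by omega)
      have hkl : k ≠ l := by rintro rfl; omega
      by_cases hB : B d k l
      · have := (φadj k l hB).2
        rw [hk', hl'] at this
        unfold IR at this; omega
      · have : (k = 0 ∧ l = d) ∨ (k = d ∧ l = 0) := by
          unfold B at hB; omega
        rcases this with ⟨rfl, rfl⟩ | ⟨rfl, rfl⟩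
        · left; exact ⟨hk', hl'⟩
        · right; exact ⟨hl', hk'⟩
    -- the tail edge at a body vertex `a ∈ {0, d}`
    have tail : ∀ a, (a = 0 ∨ a = d) → F (D e a) (D e (d + 1)) = s(φ a, D (E 1) (d + 1)) := by
      intro a ha
      have had : a ≤ d := by omega
      have hN : d + 1 ∈ Nb d a := by rcases ha with rfl | rfl <;> assumption
      have hma : m a = 0 ∨ m a = d := by
        rcases ha with rfl | rfl <;> omega
      have adja : (sunletIndicator n d).Adj (D e a) (D e (d + 1)) :=
        (adj_body had).2 ⟨_, hN, rfl⟩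
      obtain ⟨y, hy, hFy⟩ := edge_mem (hF.mem _ _ adja) (hmem a had _ hN)
      obtain ⟨l, hl, rfl⟩ := (adj_body (hm a had)).1 hy
      rw [same a had] at hFy
      have hφ : φ a = D (E 1) (m a) := by
        simp only [φ]; rw [same a had]
      rw [hφ]
      by_cases hl1 : l = d + 1
      · rw [hl1] at hFy; exact hFy
      · exfalso
        rw [mem_Nb] at hl
        have hl' : 1 ≤ l ∧ l < d := by
          have := hl.2; unfold IR at this; omega
        obtain ⟨j, hj, rfl⟩ := msurj l (by omega)
        have hj0 : j ≠ 0 := by rintro rfl; omega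
        have hjd : j ≠ d := by rintro rfl; omega
        have hB : B d a j := by unfold B; omega
        have := (hF.adj _ _ _ adja (B_adj e hB) (Dne _ _ (by omega) (by omega) (by omega))).1
        rw [Fe a j hB, hFy, hφ] at this
        apply this
        simp only [φ]
        rw [same j hj]
    have t0 := tail 0 (Or.inl rfl)
    have td := tail d (Or.inr rfl)
    simp only [φ] at t0 td
    rw [same 0 (by omega)] at t0
    rw [same d le_rfl] at td
    refine ⟨E 1, ?_, ?_⟩
    · rw [hF.symm, t0]
      rcases ends with h | h
      · left; rw [h.1]
      · right; rw [h.1]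
    · rw [hF.symm, td]
      rcases ends with h | h
      · right; rw [h.2]
      · left; rw [h.2]

end

end SunHom
namespace SunHom

section
variable {n : ℕ}

def LA {V : Type*} (p q : Sym2 V) : Prop := p ≠ q ∧ ∃ z, z ∈ p ∧ z ∈ q

lemma LA.symm {V : Type*} {p q : Sym2 V} (h : LA p q) : LA q p :=
  ⟨h.1.symm, let ⟨z, a, b⟩ := h.2; ⟨z, b, a⟩⟩

lemma four_star {z : VV n 3} {P Q R S : Sym2 (VV n 3)}
    (hP : P ∈ (sunletIndicator n 3).edgeSet) (hQ : Q ∈ (sunletIndicator n 3).edgeSet)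
    (hR : R ∈ (sunletIndicator n 3).edgeSet) (hS : S ∈ (sunletIndicator n 3).edgeSet)
    (zP : z ∈ P) (zQ : z ∈ Q) (zR : z ∈ R) (zS : z ∈ S)
    (h1 : P ≠ Q) (h2 : P ≠ R) (h3 : P ≠ S) (h4 : Q ≠ R) (h5 : Q ≠ S) (h6 : R ≠ S) : False := by
  classical
  obtain ⟨a, ha, rfl⟩ := edge_mem hP zP
  obtain ⟨b, hb, rfl⟩ := edge_mem hQ zQ
  obtain ⟨c, hc, rfl⟩ := edge_mem hR zR
  obtain ⟨e, he, rfl⟩ := edge_mem hS zS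
  have hcard : ({a, b, c, e} : Finset (VV n 3)).card = 4 := by
    rw [Finset.card_eq_succ]
    refine ⟨a, {b, c, e}, ?_, rfl, ?_⟩
    · simp only [Finset.mem_insert, Finset.mem_singleton]
      rintro (rfl | rfl | rfl)
      · exact h1 rfl
      · exact h2 rfl
      · exact h3 rfl
    · rw [Finset.card_eq_three]
      refine ⟨b, c, e, ?_, ?_, ?_, rfl⟩
      · rintro rfl; exact h4 rfl
      · rintro rfl; exact h5 rfl
      · rintro rfl; exact h6 rfl
  have := deg_le (n := n) (d := 3) le_rfl z {a, b, c, e} (by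
    intro y hy
    simp only [Finset.mem_insert, Finset.mem_singleton] at hy
    rcases hy with rfl | rfl | rfl | rfl <;> assumption)
  rcases this with h | ⟨_, _, _, _, h⟩ <;> omega

lemma K4free {P Q R S : Sym2 (VV n 3)}
    (hP : P ∈ (sunletIndicator n 3).edgeSet) (hQ : Q ∈ (sunletIndicator n 3).edgeSet)
    (hR : R ∈ (sunletIndicator n 3).edgeSet) (hS : S ∈ (sunletIndicator n 3).edgeSet)
    (h1 : LA P Q) (h2 : LA P R) (h3 : LA P S) (h4 : LA Q R) (h5 : LA Q S) (h6 : LA R S) :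
    False := by
  obtain ⟨z, hz⟩ := clique4 (Finset.univ : Finset (Fin 4)) (by simp) ![P, Q, R, S] (by
      intro i _
      fin_cases i
      · exact not_diag hP
      · exact not_diag hQ
      · exact not_diag hR
      · exact not_diag hS) (by
      intro i _ j _ hij
      fin_cases i <;> fin_cases j <;> first | exact absurd rfl hij | skip
      · exact h1
      · exact h2
      · exact h3
      · exact h1.symm
      · exact h4
      · exact h5
      · exact h2.symm
      · exact h4.symm
      · exact h6
      · exact h3.symm
      · exact h5.symm
      · exact h6.symm)
  exact four_star hP hQ hR hS (hz 0 (Finset.mem_univ _)) (hz 1 (Finset.mem_univ _))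
    (hz 2 (Finset.mem_univ _)) (hz 3 (Finset.mem_univ _)) h1.1 h2.1 h3.1 h4.1 h5.1 h6.1

lemma no5 {P X1 X2 X3 X4 X5 : Sym2 (VV n 3)}
    (hP : P ∈ (sunletIndicator n 3).edgeSet) (m1 : X1 ∈ (sunletIndicator n 3).edgeSet)
    (m2 : X2 ∈ (sunletIndicator n 3).edgeSet) (m3 : X3 ∈ (sunletIndicator n 3).edgeSet)
    (m4 : X4 ∈ (sunletIndicator n 3).edgeSet) (m5 : X5 ∈ (sunletIndicator n 3).edgeSet)
    (p1 : LA P X1) (p2 : LA P X2) (p3 : LA P X3) (p4 : LA P X4) (p5 : LA P X5)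
    (h12 : LA X1 X2) (h23 : LA X2 X3) (h34 : LA X3 X4) (h45 : LA X4 X5) (h51 : LA X5 X1) :
    False := by
  have d13 : X1 ≠ X3 := by
    rintro rfl; exact K4free hP m1 m4 m5 p1 p4 p5 h34 h51.symm h45
  have d24 : X2 ≠ X4 := by
    rintro rfl; exact K4free hP m2 m5 m1 p2 p5 p1 h45 h12.symm h51
  have d35 : X3 ≠ X5 := by
    rintro rfl; exact K4free hP m3 m1 m2 p3 p1 p2 h51 h23.symm h12
  have d41 : X4 ≠ X1 := by
    rintro rfl; exact K4free hP m4 m2 m3 p4 p2 p3 h12 h34.symm h23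
  have d52 : X5 ≠ X2 := by
    rintro rfl; exact K4free hP m5 m3 m4 p5 p3 p4 h23 h45.symm h34
  have key : ∀ z ∈ P, ∀ X Y Z, X ∈ (sunletIndicator n 3).edgeSet →
      Y ∈ (sunletIndicator n 3).edgeSet → Z ∈ (sunletIndicator n 3).edgeSet → LA P X → LA P Y →
      LA P Z → X ≠ Y → Y ≠ Z → X ≠ Z → ¬ (z ∈ X ∧ z ∈ Y ∧ z ∈ Z) := by
    rintro z hz X Y Z mX mY mZ pX pY pZ a b c ⟨zX, zY, zZ⟩
    exact four_star hP mX mY mZ hz zX zY zZ pX.1 pY.1 pZ.1 a c b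
  induction P using Sym2.ind with | _ p q =>
  have hor : ∀ X, LA s(p, q) X → p ∈ X ∨ q ∈ X := by
    rintro X ⟨_, z, hz, hzX⟩
    rw [Sym2.mem_iff] at hz
    rcases hz with rfl | rfl
    · exact Or.inl hzX
    · exact Or.inr hzX
  have kk : ∀ z ∈ s(p, q), ¬ (z ∈ X1 ∧ z ∈ X2 ∧ z ∈ X3) ∧ ¬ (z ∈ X1 ∧ z ∈ X2 ∧ z ∈ X4) ∧
      ¬ (z ∈ X1 ∧ z ∈ X2 ∧ z ∈ X5) ∧ ¬ (z ∈ X1 ∧ z ∈ X3 ∧ z ∈ X4) ∧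
      ¬ (z ∈ X1 ∧ z ∈ X3 ∧ z ∈ X5) ∧ ¬ (z ∈ X1 ∧ z ∈ X4 ∧ z ∈ X5) ∧
      ¬ (z ∈ X2 ∧ z ∈ X3 ∧ z ∈ X4) ∧ ¬ (z ∈ X2 ∧ z ∈ X3 ∧ z ∈ X5) ∧
      ¬ (z ∈ X2 ∧ z ∈ X4 ∧ z ∈ X5) ∧ ¬ (z ∈ X3 ∧ z ∈ X4 ∧ z ∈ X5) := by
    intro z hz
    refine ⟨?_, ?_, ?_, ?_, ?_, ?_, ?_, ?_, ?_, ?_⟩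
    · exact key z hz _ _ _ m1 m2 m3 p1 p2 p3 h12.1 h23.1 d13
    · exact key z hz _ _ _ m1 m2 m4 p1 p2 p4 h12.1 d24 d41.symm
    · exact key z hz _ _ _ m1 m2 m5 p1 p2 p5 h12.1 d52.symm h51.1.symm
    · exact key z hz _ _ _ m1 m3 m4 p1 p3 p4 d13 h34.1 d41.symm
    · exact key z hz _ _ _ m1 m3 m5 p1 p3 p5 d13 d35 h51.1.symm
    · exact key z hz _ _ _ m1 m4 m5 p1 p4 p5 d41.symm h45.1 h51.1.symm
    · exact key z hz _ _ _ m2 m3 m4 p2 p3 p4 h23.1 h34.1 d24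
    · exact key z hz _ _ _ m2 m3 m5 p2 p3 p5 h23.1 d35 d52.symm
    · exact key z hz _ _ _ m2 m4 m5 p2 p4 p5 d24 h45.1 d52.symm
    · exact key z hz _ _ _ m3 m4 m5 p3 p4 p5 h34.1 h45.1 d35
  have kp := kk p (by simp)
  have kq := kk q (by simp)
  have o1 := hor _ p1
  have o2 := hor _ p2
  have o3 := hor _ p3
  have o4 := hor _ p4
  have o5 := hor _ p5
  clear kk hor key
  rcases o1 with o1 | o1 <;> rcases o2 with o2 | o2 <;> rcases o3 with o3 | o3 <;>
  rcases o4 with o4 | o4 <;> rcases o5 with o5 | o5 <;> simp [*] at kp kq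

lemma tri3 {k l r : ℕ} (h1 : IR 3 k l) (h2 : IR 3 k r) (h3 : IR 3 l r) :
    k ≤ 3 ∧ l ≤ 3 ∧ r ≤ 3 := by
  unfold IR at *
  omega

lemma body3 {k l : ℕ} (hk : k ≤ 3) (_hl : l ≤ 3) (h : IR 3 k l) :
    k ≠ l ∧ ¬ (k = 0 ∧ l = 3) ∧ ¬ (k = 3 ∧ l = 0) := by
  unfold IR at *
  omega

lemma ne_of_edge {V : Type*} {G : SimpleGraph V} {a b : V} (h : s(a, b) ∈ G.edgeSet) : a ≠ b :=
  SimpleGraph.Adj.ne (G := G) h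

set_option synthInstance.maxSize 4000 in
set_option synthInstance.maxHeartbeats 400000 in
lemma num3aux : ∀ k l r t : Fin 4,
    (k.1 ≠ l.1 ∧ ¬ (k.1 = 0 ∧ l.1 = 3) ∧ ¬ (k.1 = 3 ∧ l.1 = 0)) →
    (k.1 ≠ r.1 ∧ ¬ (k.1 = 0 ∧ r.1 = 3) ∧ ¬ (k.1 = 3 ∧ r.1 = 0)) →
    (k.1 ≠ t.1 ∧ ¬ (k.1 = 0 ∧ t.1 = 3) ∧ ¬ (k.1 = 3 ∧ t.1 = 0)) →
    (l.1 ≠ r.1 ∧ ¬ (l.1 = 0 ∧ r.1 = 3) ∧ ¬ (l.1 = 3 ∧ r.1 = 0)) →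
    (l.1 ≠ t.1 ∧ ¬ (l.1 = 0 ∧ t.1 = 3) ∧ ¬ (l.1 = 3 ∧ t.1 = 0)) →
    r.1 ≠ t.1 →
    ((k.1 = 1 ∧ l.1 = 2) ∨ (k.1 = 2 ∧ l.1 = 1)) ∧
      ((r.1 = 0 ∧ t.1 = 3) ∨ (r.1 = 3 ∧ t.1 = 0)) := by
  decide +kernel

lemma num3 {k l r t : ℕ} (i1 : IR 3 k l) (i2 : IR 3 k r) (i4 : IR 3 l r) (i3 : IR 3 k t)
    (i5 : IR 3 l t) (hrt : r ≠ t) :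
    ((k = 1 ∧ l = 2) ∨ (k = 2 ∧ l = 1)) ∧ ((r = 0 ∧ t = 3) ∨ (r = 3 ∧ t = 0)) := by
  obtain ⟨l1, l2, l3⟩ := tri3 i1 i2 i4
  obtain ⟨-, -, l4⟩ := tri3 i1 i3 i5
  replace i1 := body3 l1 l2 i1
  replace i2 := body3 l1 l3 i2
  replace i3 := body3 l1 l4 i3
  replace i4 := body3 l2 l3 i4
  replace i5 := body3 l2 l4 i5
  exact num3aux ⟨k, by omega⟩ ⟨l, by omega⟩ ⟨r, by omega⟩ ⟨t, by omega⟩ i1 i2 i3 i4 i5 hrt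

lemma diamond {p q a b : VV n 3} (hpq : (sunletIndicator n 3).Adj p q)
    (hpa : (sunletIndicator n 3).Adj p a) (hqa : (sunletIndicator n 3).Adj q a)
    (hpb : (sunletIndicator n 3).Adj p b) (hqb : (sunletIndicator n 3).Adj q b) (hab : a ≠ b) :
    ∃ e, ((p = D e 1 ∧ q = D e 2) ∨ (p = D e 2 ∧ q = D e 1)) ∧
      ((a = D e 0 ∧ b = D e 3) ∨ (a = D e 3 ∧ b = D e 0)) := by
  have nl : ∀ x : Fin n ⊕ Fin n, ∀ u v : VV n 3, (sunletIndicator n 3).Adj (Sum.inl x) u →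
      (sunletIndicator n 3).Adj (Sum.inl x) v → ¬ (sunletIndicator n 3).Adj u v := by
    intro x u v hu hv huv
    rcases V_cases u with ⟨y, rfl⟩ | ⟨e, k, hk, rfl⟩
    · exact adj_ll hu
    rcases V_cases v with ⟨y, rfl⟩ | ⟨e', l, hl, rfl⟩
    · exact adj_ll hv
    rw [adj_lD hk] at hu
    rw [adj_lD hl] at hv
    rw [adj_DD hk hl] at huv
    have := huv.2
    unfold IR at this
    omega
  rcases V_cases p with ⟨x, rfl⟩ | ⟨e, k, hk, rfl⟩
  · exact absurd hqa (nl x _ _ hpq hpa)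
  rcases V_cases q with ⟨x, rfl⟩ | ⟨e', l, hl, rfl⟩
  · exact absurd hpa (nl x _ _ hpq.symm hqa)
  rcases V_cases a with ⟨x, rfl⟩ | ⟨f, r, hr, rfl⟩
  · exact absurd hpq (nl x _ _ hpa.symm hqa.symm)
  rcases V_cases b with ⟨x, rfl⟩ | ⟨f', t, ht, rfl⟩
  · exact absurd hpq (nl x _ _ hpb.symm hqb.symm)
  rw [adj_DD hk hl] at hpq
  rw [adj_DD hk hr] at hpa
  rw [adj_DD hk ht] at hpb
  rw [adj_DD hl hr] at hqa
  rw [adj_DD hl ht] at hqb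
  obtain ⟨rfl, i1⟩ := hpq
  obtain ⟨rfl, i2⟩ := hpa
  obtain ⟨rfl, i3⟩ := hpb
  have i4 := hqa.2
  have i5 := hqb.2
  have hrt : r ≠ t := by rintro rfl; exact hab rfl
  obtain ⟨c1, c2⟩ := num3 i1 i2 i4 i3 i5 hrt
  refine ⟨e, ?_, ?_⟩
  · rcases c1 with ⟨rfl, rfl⟩ | ⟨rfl, rfl⟩
    · exact Or.inl ⟨rfl, rfl⟩
    · exact Or.inr ⟨rfl, rfl⟩
  · rcases c2 with ⟨rfl, rfl⟩ | ⟨rfl, rfl⟩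
    · exact Or.inl ⟨rfl, rfl⟩
    · exact Or.inr ⟨rfl, rfl⟩

lemma meet {V : Type*} {p q a b : V} (hpq : p ≠ q) (h1 : s(p, q) ≠ s(p, a))
    (h2 : s(p, q) ≠ s(q, b)) (h : ∃ z, z ∈ s(p, a) ∧ z ∈ s(q, b)) : a = b := by
  obtain ⟨z, h3, h4⟩ := h
  simp only [Sym2.mem_iff, Sym2.eq_iff, ne_eq] at *
  grind

structure W3 (A B C D E F G : Sym2 (VV n 3)) : Prop where
  mA : A ∈ (sunletIndicator n 3).edgeSet
  mB : B ∈ (sunletIndicator n 3).edgeSet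
  mC : C ∈ (sunletIndicator n 3).edgeSet
  mD : D ∈ (sunletIndicator n 3).edgeSet
  mE : E ∈ (sunletIndicator n 3).edgeSet
  mF : F ∈ (sunletIndicator n 3).edgeSet
  mG : G ∈ (sunletIndicator n 3).edgeSet
  AB : LA A B
  AF : LA A F
  BF : LA B F
  AC : LA A C
  AD : LA A D
  CD : LA C D
  BC : LA B C
  BE : LA B E
  CE : LA C E
  DE : LA D E
  DG : LA D G
  EG : LA E G
  FG : LA F G

lemma W3.swap {A B C D E F G : Sym2 (VV n 3)} (w : W3 A B C D E F G) : W3 B A C E D F G :=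
  ⟨w.mB, w.mA, w.mC, w.mE, w.mD, w.mF, w.mG, w.AB.symm, w.BF, w.AF, w.BC, w.BE, w.CE, w.AC, w.AD,
    w.CD, w.DE.symm, w.EG, w.DG, w.FG⟩

lemma W3.neAE {A B C D E F G : Sym2 (VV n 3)} (w : W3 A B C D E F G) : A ≠ E := by
  rintro rfl
  exact no5 w.mA w.mF w.mB w.mC w.mD w.mG w.AF w.AB w.AC w.AD w.EG w.BF.symm w.BC w.CD w.DG
    w.FG.symm

lemma W3.case0 {A B C D E F G : Sym2 (VV n 3)} (w : W3 A B C D E F G) {p q : VV n 3}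
    (hC : C = s(p, q)) (pA : p ∈ A) (_pE : p ∈ E) (qB : q ∈ B) (qD : q ∈ D) : False := by
  have hne := w.swap.neAE
  have mC := w.mC
  have AC := w.AC.1
  have BC := w.BC.1
  have CD := w.CD.1
  have AB := w.AB.2
  have AD := w.AD.2
  subst hC
  have hpq : p ≠ q := ne_of_edge mC
  obtain ⟨a, rfl⟩ := pA
  obtain ⟨b, rfl⟩ := qB
  obtain ⟨c, rfl⟩ := qD
  have h1 := meet hpq AC.symm BC.symm AB
  have h2 := meet hpq AC.symm CD AD
  exact hne (by rw [← h1, h2])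

lemma W3.case1 {A B C D E F G : Sym2 (VV n 3)} (w : W3 A B C D E F G) {p q : VV n 3}
    (hC : C = s(p, q)) (pA : p ∈ A) (pB : p ∈ B) (qD : q ∈ D) (qE : q ∈ E) : False := by
  have pC : p ∈ C := by rw [hC]; simp
  have qC : q ∈ C := by rw [hC]; simp
  obtain ⟨mA, mB, mC, mD, mE, mF, mG, AB, AF, BF, AC, AD, CD, BC, BE, CE, DE, DG, EG, FG⟩ := w
  have kF : p ∈ F → F = C := by
    intro pF
    by_contra hne
    exact four_star mA mB mC mF pA pB pC pF AB.1 AC.1 AF.1 BC.1 BF.1 (Ne.symm hne)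
  have kG : q ∈ G → G = C := by
    intro qG
    by_contra hne
    exact four_star mD mE mC mG qD qE qC qG DE.1 CD.1.symm DG.1 CE.1.symm EG.1 (Ne.symm hne)
  subst hC
  have hpq : p ≠ q := ne_of_edge mC
  obtain ⟨a, rfl⟩ := pA
  obtain ⟨b, rfl⟩ := pB
  obtain ⟨a', rfl⟩ := qD
  obtain ⟨b', rfl⟩ := qE
  obtain rfl := meet hpq AC.1.symm CD.1 AD.2
  obtain rfl := meet hpq BC.1.symm CE.1 BE.2
  have hab : a ≠ b := by rintro rfl; exact AB.1 rfl
  obtain ⟨e, -, hab'⟩ := diamond mC mA mD mB mE hab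
  have nab : ¬ (sunletIndicator n 3).Adj a b := by
    rcases hab' with ⟨rfl, rfl⟩ | ⟨rfl, rfl⟩
    · exact adj_0d le_rfl
    · exact fun h => adj_0d le_rfl h.symm
  have gen : ∀ r X, X ∈ (sunletIndicator n 3).edgeSet → LA s(r, a) X → LA s(r, b) X → r ∈ X := by
    rintro r X mX ⟨-, z, hz, zX⟩ ⟨-, y, hy, yX⟩
    rw [Sym2.mem_iff] at hz hy
    rcases hz with rfl | rfl
    · exact zX
    rcases hy with rfl | rfl
    · exact yX
    have := pair_eq hab zX yX
    subst this
    exact absurd mX nab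
  exact FG.1 ((kF (gen p F mF AF BF)).trans (kG (gen q G mG DG EG)).symm)

lemma tail3 {e : Fin n × Fin 2} {p q a : VV n 3} {X : Sym2 (VV n 3)}
    (hpq : (p = D e 1 ∧ q = D e 2) ∨ (p = D e 2 ∧ q = D e 1)) (ha : a = D e 0 ∨ a = D e 3)
    (mX : X ∈ (sunletIndicator n 3).edgeSet) (aX : a ∈ X) (h1 : s(p, a) ≠ X) (h2 : s(q, a) ≠ X) :
    T e X := by
  obtain ⟨y, hy, rfl⟩ := edge_mem mX aX
  have h1' : s(D e 1, a) ≠ s(a, y) ∧ s(D e 2, a) ≠ s(a, y) := by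
    rcases hpq with ⟨rfl, rfl⟩ | ⟨rfl, rfl⟩
    · exact ⟨h1, h2⟩
    · exact ⟨h2, h1⟩
  obtain ⟨k1, k2⟩ := h1'
  have key : ∀ k, (k = 0 ∨ k = 3) → a = D e k → T e s(a, y) := by
    rintro k hk rfl
    obtain ⟨l, hl, rfl⟩ := (adj_body (by omega)).1 hy
    rw [mem_Nb] at hl
    have hl1 : l ≠ 1 := by rintro rfl; exact k1 Sym2.eq_swap
    have hl2 : l ≠ 2 := by rintro rfl; exact k2 Sym2.eq_swap
    have : l = 4 := by
      have := hl.2; unfold IR at this; omega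
    subst this
    rcases hk with rfl | rfl
    · left; rfl
    · right; rfl
  rcases ha with ha | ha
  · exact key 0 (by omega) ha
  · exact key 3 (by omega) ha

lemma W3.case2 {A B C D E F G : Sym2 (VV n 3)} (w : W3 A B C D E F G) {p q : VV n 3}
    (hC : C = s(p, q)) (pA : p ∈ A) (pD : p ∈ D) (qB : q ∈ B) (qE : q ∈ E) :
    ∃ e, T e F ∧ T e G := by
  obtain ⟨mA, mB, mC, mD, mE, mF, mG, AB, AF, BF, AC, AD, CD, BC, BE, CE, DE, DG, EG, FG⟩ := w
  subst hC
  have hpq : p ≠ q := ne_of_edge mC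
  obtain ⟨a, rfl⟩ := pA
  obtain ⟨b, rfl⟩ := pD
  obtain ⟨a', rfl⟩ := qB
  obtain ⟨b', rfl⟩ := qE
  obtain rfl := meet hpq AC.1.symm BC.1.symm AB.2
  obtain rfl := meet hpq CD.1 CE.1 DE.2
  have hab : a ≠ b := by rintro rfl; exact AD.1 rfl
  obtain ⟨e, hpq', hab'⟩ := diamond mC mA mB mD mE hab
  have gen : ∀ c X, LA s(p, c) X → LA s(q, c) X → c ∈ X ∨ X = s(p, q) := by
    rintro c X ⟨-, z, hz, zX⟩ ⟨-, y, hy, yX⟩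
    rw [Sym2.mem_iff] at hz hy
    rcases hz with rfl | rfl
    · rcases hy with rfl | rfl
      · exact Or.inr (pair_eq hpq zX yX)
      · exact Or.inl yX
    · exact Or.inl zX
  have gen2 : ∀ c X Y, LA s(p, c) X → LA s(q, c) X → Y = s(p, q) → LA X Y → p ≠ c → q ≠ c →
      False := by
    rintro c X Y h1 h2 rfl ⟨h3, z, zX, zY⟩ hpc hqc
    have hc := (gen c X h1 h2).resolve_right h3
    rw [Sym2.mem_iff] at zY
    rcases zY with rfl | rfl
    · exact h1.1 (pair_eq hpc zX hc).symm
    · exact h2.1 (pair_eq hqc zX hc).symm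
  have pa : p ≠ a := ne_of_edge mA
  have qa : q ≠ a := ne_of_edge mB
  have pb : p ≠ b := ne_of_edge mD
  have qb : q ≠ b := ne_of_edge mE
  have aF := (gen a F AF BF).resolve_right (fun h => gen2 b G F DG EG h FG.symm pb qb)
  have bG := (gen b G DG EG).resolve_right (fun h => gen2 a F G AF BF h FG pa qa)
  refine ⟨e, tail3 hpq' ?_ mF aF AF.1 BF.1, tail3 hpq' ?_ mG bG DG.1 EG.1⟩
  · rcases hab' with h | h
    · exact Or.inl h.1
    · exact Or.inr h.1
  · rcases hab' with h | h
    · exact Or.inr h.2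
    · exact Or.inl h.2

lemma W3.main {A B C D E F G : Sym2 (VV n 3)} (w : W3 A B C D E F G) : ∃ e, T e F ∧ T e G := by
  have nAE := w.neAE
  have nBD := w.swap.neAE
  obtain ⟨p, q, hC⟩ : ∃ p q, C = s(p, q) := by
    induction C using Sym2.ind with | _ p q => exact ⟨p, q, rfl⟩
  have hC' : C = s(q, p) := hC.trans Sym2.eq_swap
  have hor : ∀ X, LA C X → p ∈ X ∨ q ∈ X := by
    rintro X ⟨_, z, hz, hzX⟩
    rw [hC, Sym2.mem_iff] at hz
    rcases hz with rfl | rfl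
    · exact Or.inl hzX
    · exact Or.inr hzX
  have k : ∀ z ∈ C, ¬ (z ∈ A ∧ z ∈ B ∧ z ∈ D) ∧ ¬ (z ∈ A ∧ z ∈ B ∧ z ∈ E) ∧
      ¬ (z ∈ A ∧ z ∈ D ∧ z ∈ E) ∧ ¬ (z ∈ B ∧ z ∈ D ∧ z ∈ E) := by
    intro z hz
    refine ⟨?_, ?_, ?_, ?_⟩
    · rintro ⟨a, b, c⟩
      exact four_star w.mC w.mA w.mB w.mD hz a b c w.AC.1.symm w.BC.1.symm w.CD.1 w.AB.1 w.AD.1 nBD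
    · rintro ⟨a, b, c⟩
      exact four_star w.mC w.mA w.mB w.mE hz a b c w.AC.1.symm w.BC.1.symm w.CE.1 w.AB.1 nAE w.BE.1
    · rintro ⟨a, b, c⟩
      exact four_star w.mC w.mA w.mD w.mE hz a b c w.AC.1.symm w.CD.1 w.CE.1 w.AD.1 nAE w.DE.1
    · rintro ⟨a, b, c⟩
      exact four_star w.mC w.mB w.mD w.mE hz a b c w.BC.1.symm w.CD.1 w.CE.1 nBD w.BE.1 w.DE.1
  obtain ⟨p1, p2, p3, p4⟩ := k p (by rw [hC]; simp)
  obtain ⟨q1, q2, q3, q4⟩ := k q (by rw [hC]; simp)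
  rcases hor A w.AC.symm with a | a <;> rcases hor B w.BC.symm with b | b <;>
  rcases hor D w.CD with c | c <;> rcases hor E w.CE with e | e
  · exact absurd ⟨a, b, c⟩ p1
  · exact absurd ⟨a, b, c⟩ p1
  · exact absurd ⟨a, b, e⟩ p2
  · exact (w.case1 hC a b c e).elim
  · exact absurd ⟨a, c, e⟩ p3
  · exact w.case2 hC a c b e
  · exact (w.case0 hC a e b c).elim
  · exact absurd ⟨b, c, e⟩ q4
  · exact absurd ⟨b, c, e⟩ p4
  · exact (w.case0 hC' a e b c).elim
  · exact w.case2 hC' a c b e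
  · exact absurd ⟨a, c, e⟩ q3
  · exact (w.case1 hC' a b c e).elim
  · exact absurd ⟨a, b, e⟩ q2
  · exact absurd ⟨a, b, c⟩ q1
  · exact absurd ⟨a, b, c⟩ q1

lemma tails_3 {n n' : ℕ} {F : VV n 3 → VV n 3 → Sym2 (VV n' 3)}
    (hF : LH (sunletIndicator n 3) (sunletIndicator n' 3) F) : Tails F := by
  intro e
  have adj : ∀ k l, k < 6 → l < 6 → IR 3 k l →
      (sunletIndicator n 3).Adj (D e k) (D e l) := fun k l hk hl h =>
    (adj_DD hk hl).2 ⟨rfl, h⟩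
  have la : ∀ u v w, u < 6 → v < 6 → w < 6 → IR 3 u v → IR 3 u w → v ≠ w →
      LA (F (D e u) (D e v)) (F (D e u) (D e w)) := by
    intro u v w hu hv hw h1 h2 h3
    refine hF.adj _ _ _ (adj u v hu hv h1) (adj u w hu hw h2) ?_
    rw [Ne, D_inj hv hw]
    exact fun h => h3 h.2
  have mm : ∀ k l, k < 6 → l < 6 → IR 3 k l →
      F (D e k) (D e l) ∈ (sunletIndicator n' 3).edgeSet := fun k l hk hl h =>
    hF.mem _ _ (adj k l hk hl h)
  have sy : ∀ k l, F (D e k) (D e l) = F (D e l) (D e k) := fun k l => hF.symm _ _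
  have w : W3 (F (D e 0) (D e 1)) (F (D e 0) (D e 2)) (F (D e 1) (D e 2)) (F (D e 1) (D e 3))
      (F (D e 2) (D e 3)) (F (D e 4) (D e 0)) (F (D e 4) (D e 3)) := by
    refine ⟨mm _ _ ?_ ?_ ?_, mm _ _ ?_ ?_ ?_, mm _ _ ?_ ?_ ?_, mm _ _ ?_ ?_ ?_, mm _ _ ?_ ?_ ?_,
      mm _ _ ?_ ?_ ?_, mm _ _ ?_ ?_ ?_, ?_, ?_, ?_, ?_, ?_, ?_, ?_, ?_, ?_, ?_, ?_, ?_, ?_⟩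
    case refine_22 => exact la 0 1 2 (by decide) (by decide) (by decide) (by decide) (by decide) (by decide)
    case refine_23 => rw [sy 4 0]; exact la 0 1 4 (by decide) (by decide) (by decide) (by decide) (by decide) (by decide)
    case refine_24 => rw [sy 4 0]; exact la 0 2 4 (by decide) (by decide) (by decide) (by decide) (by decide) (by decide)
    case refine_25 => rw [sy 0 1]; exact la 1 0 2 (by decide) (by decide) (by decide) (by decide) (by decide) (by decide)
    case refine_26 => rw [sy 0 1]; exact la 1 0 3 (by decide) (by decide) (by decide) (by decide) (by decide) (by decide)
    case refine_27 => exact la 1 2 3 (by decide) (by decide) (by decide) (by decide) (by decide) (by decide)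
    case refine_28 => rw [sy 0 2, sy 1 2]; exact la 2 0 1 (by decide) (by decide) (by decide) (by decide) (by decide) (by decide)
    case refine_29 => rw [sy 0 2]; exact la 2 0 3 (by decide) (by decide) (by decide) (by decide) (by decide) (by decide)
    case refine_30 => rw [sy 1 2]; exact la 2 1 3 (by decide) (by decide) (by decide) (by decide) (by decide) (by decide)
    case refine_31 => rw [sy 1 3, sy 2 3]; exact la 3 1 2 (by decide) (by decide) (by decide) (by decide) (by decide) (by decide)
    case refine_32 => rw [sy 1 3, sy 4 3]; exact la 3 1 4 (by decide) (by decide) (by decide) (by decide) (by decide) (by decide)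
    case refine_33 => rw [sy 2 3, sy 4 3]; exact la 3 2 4 (by decide) (by decide) (by decide) (by decide) (by decide) (by decide)
    case refine_34 => exact la 4 0 3 (by decide) (by decide) (by decide) (by decide) (by decide) (by decide)
    all_goals decide
  exact w.main

end

end SunHom

/-- **Homomorphisms between the line graphs of `G_{n,d}` model divisibility.**
For `d, n, n' ≥ 3` there is a graph homomorphism `L(G_{n,d}) → L(G_{n',d})`
iff `n'` divides `n`. -/
theorem lineGraph_sunletIndicator_hom_iff_dvd (d n n' : ℕ)
    (hd : 3 ≤ d) (hn : 3 ≤ n) (hn' : 3 ≤ n') :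
    Nonempty ((sunletIndicator n d).lineGraph →g (sunletIndicator n' d).lineGraph) ↔
      n' ∣ n := by
  constructor
  · rintro ⟨f⟩
    have : Nonempty (SunHom.VV n' d) := ⟨Sum.inl (Sum.inl ⟨0, by omega⟩)⟩
    obtain ⟨F, hF⟩ := SunHom.exists_LH _ _ f
    refine SunHom.dvd_of_tails hd hn hF ?_
    rcases Nat.lt_or_ge 3 d with h | h
    · exact SunHom.tails_ge4 h hF
    · obtain rfl : d = 3 := by omega
      exact SunHom.tails_3 hF
  · exact SunHom.hom_of_dvd d n n' hn'
end
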